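/- arXiv:1403.2457 — 5 statements merged into one kernel-verified Lean document; each statement's English description precedes it below -/
import Mathlib

section
/- Let X = [0,1) with its Borel σ-field B and Lebesgue measure μ, let T be an invertible ergodic measure-preserving transformation of ([0,1), B, μ), and let C ⊆ B be a family of Borel sets with H_μ(C) > 0. Then there exists δ > 0 such that for every N ≥ 1 the set G_N(T, δ) = {φ ∈ Φ : sup_{n ≥ N} sup_{C ∈ C} ∫ |(1/n) Σ_{i=0}^{n-1} 1_C(T_φ^i x) − μ(C)| dμ(x) > δ} is dense in Φ. -/
open MeasureTheory Filter

/-- Entropy (base 2) of the join of the sets `C 0, …, C (n-1)`: the cells of the join are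
indexed by sign patterns `s : Fin n → Bool`; cells of measure zero contribute `0`. -/
noncomputable def joinEntropy {X : Type*} [MeasurableSpace X] (μ : Measure X)
    {n : ℕ} (C : Fin n → Set X) : ℝ :=
  ∑ s : Fin n → Bool,
    -((μ (⋂ i, if s i then C i else (C i)ᶜ)).toReal *
      Real.logb 2 (μ (⋂ i, if s i then C i else (C i)ᶜ)).toReal)

/-- Entropy of a family `𝒞` of measurable sets: the supremum over all sequences of sets
from `𝒞` of `liminf (1/n) H_μ(⋁_{i<n} C_i)`. -/
noncomputable def famEntropy {X : Type*} [MeasurableSpace X] (μ : Measure X)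
    (𝒞 : Set (Set X)) : ℝ :=
  ⨆ S : {f : ℕ → Set X // ∀ i, f i ∈ 𝒞},
    Filter.liminf (fun n : ℕ => joinEntropy μ (fun i : Fin n => S.1 i) / n) Filter.atTop

/-- The mean deviation `∫ |(1/n) ∑_{i<n} 1_C(T^i x) − μ(C)| dμ` of the Birkhoff average. -/
noncomputable def birkDev {X : Type*} [MeasurableSpace X] (μ : Measure X)
    (T : X → X) (C : Set X) (n : ℕ) : ℝ :=
  ∫ x, |(∑ i ∈ Finset.range n, C.indicator (fun _ => (1 : ℝ)) (T^[i] x)) / n - (μ C).toReal| ∂μ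

open scoped symmDiff

/-- Lebesgue measure on the unit interval `[0,1)` (with its Borel σ-field, given by the
subtype measurable-space structure). -/
noncomputable def lebesgue01 : Measure (Set.Ico (0 : ℝ) 1) :=
  (volume : Measure ℝ).comap Subtype.val

/-- The space of invertible measure preserving transformations of `([0,1), ℬ, μ)`
(representatives of the equivalence classes mod 0). -/
def MPE01 : Type :=
  {e : Set.Ico (0 : ℝ) 1 ≃ᵐ Set.Ico (0 : ℝ) 1 // MeasurePreserving e lebesgue01 lebesgue01}

/-- The conjugate transformation `T_φ = φ⁻¹ ∘ T ∘ φ`. -/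
def MPE01.conj (T φ : MPE01) : Set.Ico (0 : ℝ) 1 → Set.Ico (0 : ℝ) 1 :=
  fun x => φ.1.symm (T.1 (φ.1 x))

/-- The metric `d(φ, ψ) = ∑_{i≥1} 2⁻ⁱ [μ(φE_i ∆ ψE_i) + μ(φ⁻¹E_i ∆ ψ⁻¹E_i)]` on `Φ`
attached to a sequence `E` of generating sets (here `E i` plays the role of `E_{i+1}`;
the forward image `φ A` equals `φ.symm ⁻¹' A`). -/
noncomputable def wdist01 (E : ℕ → Set (Set.Ico (0 : ℝ) 1)) (φ ψ : MPE01) : ℝ :=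
  ∑' i : ℕ, (2 : ℝ)⁻¹ ^ (i + 1) *
    ((lebesgue01 ((⇑φ.1.symm ⁻¹' E i) ∆ (⇑ψ.1.symm ⁻¹' E i))).toReal +
     (lebesgue01 ((⇑φ.1 ⁻¹' E i) ∆ (⇑ψ.1 ⁻¹' E i))).toReal)

/-- The set `G_N(T, δ)` of those `φ ∈ Φ` for which some Birkhoff average of length `n ≥ N`
of the indicator of some `C ∈ 𝒞` under `T_φ` deviates from `μ C` by more than `δ` in mean
(i.e. `sup_{n ≥ N} sup_{C ∈ 𝒞} ∫ |(1/n) ∑_{i<n} 1_C(T_φ^i x) − μ C| dμ > δ`). -/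
def GN01 (T : MPE01) (𝒞 : Set (Set (Set.Ico (0 : ℝ) 1))) (δ : ℝ) (N : ℕ) : Set MPE01 :=
  {φ : MPE01 | ∃ n ≥ N, ∃ C ∈ 𝒞, birkDev lebesgue01 (MPE01.conj T φ) C n > δ}

lemma mean_erg_aux {X : Type*} [MeasurableSpace X] {μ : Measure X} [IsProbabilityMeasure μ]
    {S : X → X} (hS : Ergodic S μ) {A : Set X} (hA : MeasurableSet A) {η : ℝ} (hη : 0 < η) :
    ∀ᶠ M : ℕ in atTop, ∀ Y : Set X, MeasurableSet Y →
      |(M : ℝ)⁻¹ * (∑ i ∈ Finset.range M, μ.real (Y ∩ S^[i] ⁻¹' A)) - μ.real Y * μ.real A| ≤ η := by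
  have hmp : MeasurePreserving S μ μ := hS.toMeasurePreserving
  let U : Lp ℝ 2 μ →L[ℝ] Lp ℝ 2 μ :=
    (Lp.compMeasurePreservingₗᵢ ℝ S hmp).toContinuousLinearMap
  have hU : ‖U‖ ≤ 1 := LinearIsometry.norm_toContinuousLinearMap_le _
  let x : Lp ℝ 2 μ := indicatorConstLp 2 hA (measure_ne_top μ A) (1 : ℝ)
  have hlim := U.tendsto_birkhoffAverage_orthogonalProjection hU x
  set pp := (U.eqLocus (1 : Lp ℝ 2 μ →L[ℝ] Lp ℝ 2 μ)).orthogonalProjectionOnto x with hpp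
  have hfix : U (pp : Lp ℝ 2 μ) = pp := by
    have := pp.2
    simpa using this
  set p : Lp ℝ 2 μ := (pp : Lp ℝ 2 μ) with hp
  obtain ⟨c, hc⟩ : ∃ c, (p : X → ℝ) =ᵐ[μ] Function.const X c := by
    refine hS.ae_eq_const_of_ae_eq_comp_ae (Lp.aestronglyMeasurable p) ?_
    have h1 := Lp.coeFn_compMeasurePreserving p hmp
    have h2 : Lp.compMeasurePreserving S hmp p = p := hfix
    rw [h2] at h1
    exact h1.symm
  have hpY : ∀ Y : Set X, ∀ hY : MeasurableSet Y,
      inner ℝ (indicatorConstLp 2 hY (measure_ne_top μ Y) (1 : ℝ)) p = μ.real Y * c := by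
    intro Y hY
    rw [L2.inner_indicatorConstLp_one]
    rw [setIntegral_congr_ae (g := fun _ => c) hY (hc.mono fun x hx _ => hx)]
    simp
  have hit : ∀ i : ℕ, U^[i] x = indicatorConstLp 2 ((hmp.iterate i).measurable hA)
      (measure_ne_top μ _) (1 : ℝ) := by
    intro i
    have h1 : (⇑U)^[i] = ⇑(Lp.compMeasurePreserving (E := ℝ) (p := 2) S^[i] (hmp.iterate i)) := by
      rw [← Lp.compMeasurePreserving_iterate]; rfl
    rw [h1]
    exact Lp.indicatorConstLp_compMeasurePreserving hA (measure_ne_top μ A) 1 _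
  have hav : ∀ (M : ℕ) (Y : Set X) (hY : MeasurableSet Y),
      inner ℝ (indicatorConstLp 2 hY (measure_ne_top μ Y) (1 : ℝ)) (birkhoffAverage ℝ U id M x)
        = (M : ℝ)⁻¹ * (∑ i ∈ Finset.range M, μ.real (Y ∩ S^[i] ⁻¹' A)) := by
    intro M Y hY
    simp only [birkhoffAverage, birkhoffSum, id, inner_smul_right, inner_sum, hit]
    congr 1
    refine Finset.sum_congr rfl fun i _ => ?_
    rw [L2.real_inner_indicatorConstLp_one_indicatorConstLp_one]
  have hnorm : ∀ (Y : Set X) (hY : MeasurableSet Y),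
      ‖indicatorConstLp 2 hY (measure_ne_top μ Y) (1 : ℝ)‖ ≤ 1 := by
    intro Y hY
    refine norm_indicatorConstLp_le.trans ?_
    rw [norm_one, one_mul]
    exact Real.rpow_le_one measureReal_nonneg measureReal_le_one (by positivity)
  have key : ∀ η' : ℝ, 0 < η' → ∀ᶠ M : ℕ in atTop, ∀ Y : Set X, MeasurableSet Y →
      |(M : ℝ)⁻¹ * (∑ i ∈ Finset.range M, μ.real (Y ∩ S^[i] ⁻¹' A)) - μ.real Y * c| ≤ η' := by
    intro η' hη'
    have := (Metric.tendsto_nhds.1 hlim) η' hη'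
    filter_upwards [this] with M hM Y hY
    rw [← hav M Y hY, ← hpY Y hY, ← inner_sub_right]
    rw [dist_eq_norm] at hM
    calc _ ≤ _ := abs_real_inner_le_norm _ _
      _ ≤ 1 * η' := by
        gcongr
        exact hnorm Y hY
      _ = η' := one_mul _
  have hcA : c = μ.real A := by
    have h0 : ∀ η' : ℝ, 0 < η' → |μ.real A - c| ≤ η' := by
      intro η' hη'
      obtain ⟨M, hM, hM0⟩ := ((key η' hη').and (eventually_gt_atTop 0)).exists
      have h := hM Set.univ MeasurableSet.univ
      have h3 : ∀ i, μ.real (S^[i] ⁻¹' A) = μ.real A := fun i => by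
        simp only [measureReal_def]
        rw [(hmp.iterate i).measure_preimage hA.nullMeasurableSet]
      have hM' : (M : ℝ) ≠ 0 := by positivity
      simpa [h3, hM'] using h
    have : |μ.real A - c| ≤ 0 := le_of_forall_pos_le_add (by simpa using h0)
    have := abs_nonpos_iff.1 this
    linarith
  rw [← hcA]
  exact key η hη
lemma almost_inv_iter {X : Type*} [MeasurableSpace X] {μ : Measure X} [IsProbabilityMeasure μ]
    {S : X → X} (hS : MeasurePreserving S μ μ) {Y : Set X} (hY : MeasurableSet Y) {ε : ℝ}
    (h : μ.real (S ⁻¹' Y \ Y) ≤ ε) (i : ℕ) : μ.real (S^[i] ⁻¹' Y \ Y) ≤ i * ε := by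
  induction i with
  | zero => simp
  | succ i ih =>
    have hsub : S^[i+1] ⁻¹' Y \ Y ⊆ S^[i] ⁻¹' (S ⁻¹' Y \ Y) ∪ (S^[i] ⁻¹' Y \ Y) := by
      intro x hx
      have h1 : S (S^[i] x) ∈ Y := by
        have := hx.1
        rwa [Set.mem_preimage, Function.iterate_succ_apply'] at this
      by_cases h2 : S^[i] x ∈ Y
      · exact Or.inr ⟨h2, hx.2⟩
      · exact Or.inl ⟨h1, h2⟩
    have h3 : μ.real (S^[i] ⁻¹' (S ⁻¹' Y \ Y)) = μ.real (S ⁻¹' Y \ Y) := by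
      simp only [measureReal_def]
      rw [(hS.iterate i).measure_preimage ((hS.measurable hY).diff hY).nullMeasurableSet]
    calc _ ≤ _ := measureReal_mono hsub
      _ ≤ _ := measureReal_union_le _ _
      _ ≤ ε + i * ε := by rw [h3]; gcongr
      _ = _ := by push_cast; ring

lemma almost_inv_inter {X : Type*} [MeasurableSpace X] {μ : Measure X} [IsProbabilityMeasure μ]
    {S : X → X} (hS : MeasurePreserving S μ μ) {Y : Set X} (hY : MeasurableSet Y) {ε : ℝ}
    (h : μ.real (S ⁻¹' Y \ Y) ≤ ε) (i : ℕ) {B : Set X} (hB : MeasurableSet B) :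
    |μ.real (Y ∩ S^[i] ⁻¹' B) - μ.real (Y ∩ B)| ≤ i * ε := by
  have h1 := almost_inv_iter hS hY h i
  have hYi : MeasurableSet (S^[i] ⁻¹' Y) := (hS.iterate i).measurable hY
  have hBi : MeasurableSet (S^[i] ⁻¹' B) := (hS.iterate i).measurable hB
  have h2 : μ.real (Y \ S^[i] ⁻¹' Y) = μ.real (S^[i] ⁻¹' Y \ Y) := by
    have e1 := measureReal_inter_add_sdiff (μ := μ) (s := Y) hYi
    have e2 := measureReal_inter_add_sdiff (μ := μ) (s := S^[i] ⁻¹' Y) hY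
    have e3 : μ.real (S^[i] ⁻¹' Y) = μ.real Y := by
      simp only [measureReal_def]
      rw [(hS.iterate i).measure_preimage hY.nullMeasurableSet]
    rw [Set.inter_comm] at e2
    linarith
  have h3 : μ.real (Y ∩ B) = μ.real (S^[i] ⁻¹' Y ∩ S^[i] ⁻¹' B) := by
    rw [← Set.preimage_inter]
    simp only [measureReal_def]
    rw [(hS.iterate i).measure_preimage (hY.inter hB).nullMeasurableSet]
  have h4 : μ.real (Y ∩ S^[i] ⁻¹' B) ≤
      μ.real (S^[i] ⁻¹' Y ∩ S^[i] ⁻¹' B) + μ.real (Y \ S^[i] ⁻¹' Y) := by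
    refine (measureReal_mono ?_).trans (measureReal_union_le _ _)
    intro x hx
    by_cases h : x ∈ S^[i] ⁻¹' Y
    · exact Or.inl ⟨h, hx.2⟩
    · exact Or.inr ⟨hx.1, h⟩
  have h5 : μ.real (S^[i] ⁻¹' Y ∩ S^[i] ⁻¹' B) ≤
      μ.real (Y ∩ S^[i] ⁻¹' B) + μ.real (S^[i] ⁻¹' Y \ Y) := by
    refine (measureReal_mono ?_).trans (measureReal_union_le _ _)
    intro x hx
    by_cases h : x ∈ Y
    · exact Or.inl ⟨h, hx.2⟩
    · exact Or.inr ⟨hx.1, h⟩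
  rw [abs_le]
  constructor <;> linarith

lemma ergodic_sweep {X : Type*} [MeasurableSpace X] {μ : Measure X} [IsProbabilityMeasure μ]
    {S : X → X} (hS : Ergodic S μ) {E : Set X} (hE : MeasurableSet E) (h0 : μ E ≠ 0) :
    ∀ᵐ x ∂μ, ∃ k : ℕ, S^[k] x ∈ E := by
  have hm : MeasurableSet (⋃ k : ℕ, S^[k] ⁻¹' E) :=
    MeasurableSet.iUnion fun k => (hS.toMeasurePreserving.iterate k).measurable hE
  have hsub : S ⁻¹' (⋃ k : ℕ, S^[k] ⁻¹' E) ⊆ ⋃ k : ℕ, S^[k] ⁻¹' E := by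
    intro x hx
    simp only [Set.mem_preimage, Set.mem_iUnion] at hx ⊢
    obtain ⟨k, hk⟩ := hx
    exact ⟨k + 1, by simpa using hk⟩
  rcases hS.ae_empty_or_univ_of_preimage_ae_le hm.nullMeasurableSet
    (LE.le.eventuallyLE hsub) with h | h
  · exfalso
    apply h0
    have h1 : μ (⋃ k : ℕ, S^[k] ⁻¹' E) = 0 := by simpa using measure_congr h
    exact measure_mono_null (fun x hx => Set.mem_iUnion.2 ⟨0, hx⟩) h1
  · filter_upwards [h] with x hx
    have : x ∈ ⋃ k : ℕ, S^[k] ⁻¹' E := by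
      have : (⋃ k : ℕ, S^[k] ⁻¹' E) x := by rw [hx]; trivial
      exact this
    simpa using this

lemma exists_almost_inv {X : Type*} [MeasurableSpace X] {μ : Measure X} [IsProbabilityMeasure μ]
    {S : X → X} (hS : Ergodic S μ)
    (hat : ∀ ε : ℝ, 0 < ε → ∃ E : Set X, MeasurableSet E ∧ 0 < μ.real E ∧ μ.real E ≤ ε)
    {ε : ℝ} (hε : 0 < ε) : ∃ Y : Set X, MeasurableSet Y ∧ 1 / 2 ≤ μ.real Y ∧ μ.real Y ≤ 1 / 2 + ε ∧
      μ.real (S ⁻¹' Y \ Y) ≤ ε := by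
  have hmp := hS.toMeasurePreserving
  obtain ⟨E, hE, hE0, hEε⟩ := hat ε hε
  let Z : ℕ → Set X := fun j => ⋃ k ∈ Finset.range j, S^[k] ⁻¹' E
  have hZm : ∀ j, MeasurableSet (Z j) := fun j =>
    Finset.measurableSet_biUnion _ fun k _ => (hmp.iterate k).measurable hE
  have hSE : ∀ k, μ.real (S^[k] ⁻¹' E) = μ.real E := fun k => by
    simp only [measureReal_def]
    rw [(hmp.iterate k).measure_preimage hE.nullMeasurableSet]
  have hZs : ∀ j, Z (j + 1) = Z j ∪ S^[j] ⁻¹' E := by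
    intro j
    ext x
    simp only [Z, Set.mem_iUnion, Finset.mem_range, Set.mem_union, Nat.lt_succ_iff_lt_or_eq]
    constructor
    · rintro ⟨k, h | h, hx⟩
      · exact Or.inl ⟨k, h, hx⟩
      · exact Or.inr (h ▸ hx)
    · rintro (⟨k, h, hx⟩ | hx)
      · exact ⟨k, Or.inl h, hx⟩
      · exact ⟨j, Or.inr rfl, hx⟩
  have hmono : Monotone Z := monotone_nat_of_le_succ fun j => by
    rw [hZs]; exact Set.subset_union_left
  have hU : μ (⋃ j, Z j) = 1 := by
    rw [prob_compl_eq_zero_iff (MeasurableSet.iUnion hZm) |>.symm]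
    have := ergodic_sweep hS hE (fun h => by simp [measureReal_def, h] at hE0)
    rw [ae_iff] at this
    refine measure_mono_null ?_ this
    intro x hx
    simp only [Set.mem_compl_iff, Set.mem_iUnion, not_exists, Z, Set.mem_preimage] at hx
    rintro ⟨k, hk⟩
    exact hx (k + 1) k (by simp) hk
  have hlim := tendsto_measure_iUnion_atTop (μ := μ) hmono
  rw [hU] at hlim
  have hlim' : Tendsto (fun j => μ.real (Z j)) atTop (nhds 1) := by
    have := (ENNReal.tendsto_toReal ENNReal.one_ne_top).comp hlim
    rw [ENNReal.toReal_one] at this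
    exact this
  have hex : ∃ j, 1 / 2 ≤ μ.real (Z j) :=
    ((hlim'.eventually (lt_mem_nhds (by norm_num : (1/2 : ℝ) < 1))).exists).imp fun _ h => h.le
  classical
  obtain ⟨j, hj, hmin⟩ : ∃ j, 1 / 2 ≤ μ.real (Z (j + 1)) ∧ μ.real (Z j) < 1 / 2 := by
    have h1 := Nat.find_spec hex
    rcases hn : Nat.find hex with _ | n
    · rw [hn] at h1
      simp [Z] at h1
      norm_num at h1
    · refine ⟨n, hn ▸ h1, ?_⟩
      have := Nat.find_min hex (m := n) (by omega)
      exact not_le.1 this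
  refine ⟨Z (j + 1), hZm _, hj, ?_, ?_⟩
  · rw [hZs]
    calc _ ≤ _ := measureReal_union_le _ _
      _ ≤ _ := by rw [hSE]; linarith
  · calc _ ≤ μ.real (S^[j + 1] ⁻¹' E) := by
          refine measureReal_mono ?_ (measure_ne_top _ _)
          rintro x ⟨hx1, hx2⟩
          simp only [Z, Set.mem_preimage, Set.mem_iUnion, Finset.mem_range, not_exists] at hx1 hx2
          obtain ⟨k, hk, hx⟩ := hx1
          rcases Nat.lt_or_ge (k + 1) (j + 1) with h | h
          · exact absurd (by simpa using hx) (hx2 (k + 1) h)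
          · obtain rfl : k = j := by omega
            simpa using hx
      _ ≤ ε := by rw [hSE]; exact hEε

lemma exists_Y {X : Type*} [MeasurableSpace X] {μ : Measure X} [IsProbabilityMeasure μ]
    {S : X → X} (hS : Ergodic S μ)
    (hat : ∀ ε : ℝ, 0 < ε → ∃ E : Set X, MeasurableSet E ∧ 0 < μ.real E ∧ μ.real E ≤ ε)
    {ι : Type*} [Fintype ι] (A : ι → Set X) (hA : ∀ j, MeasurableSet (A j))
    {η : ℝ} (hη : 0 < η) : ∃ Y : Set X, MeasurableSet Y ∧ 1 / 2 ≤ μ.real Y ∧ μ.real Y ≤ 1 / 2 + η ∧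
      (∀ j, |μ.real (Y ∩ A j) - μ.real Y * μ.real (A j)| ≤ η) ∧ μ.real (S ⁻¹' Y \ Y) ≤ η := by
  have hmp := hS.toMeasurePreserving
  have h1 : ∀ᶠ M : ℕ in atTop, ∀ j, ∀ Y : Set X, MeasurableSet Y →
      |(M : ℝ)⁻¹ * (∑ i ∈ Finset.range M, μ.real (Y ∩ S^[i] ⁻¹' (A j)))
        - μ.real Y * μ.real (A j)| ≤ η / 2 :=
    eventually_all.2 fun j => mean_erg_aux hS (hA j) (half_pos hη)
  obtain ⟨M, hM, hM0⟩ := (h1.and (eventually_gt_atTop 0)).exists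
  have hMr : (0 : ℝ) < M := by exact_mod_cast hM0
  have hM1 : (1 : ℝ) ≤ M := by exact_mod_cast hM0
  have hε : 0 < η / (2 * M) := by positivity
  have hεη : η / (2 * M) ≤ η := by
    apply div_le_self hη.le; linarith
  obtain ⟨Y, hY, hY1, hY2, hY3⟩ := exists_almost_inv hS hat hε
  refine ⟨Y, hY, hY1, by linarith, ?_, by linarith⟩
  intro j
  have h2 := hM j Y hY
  have h3 : |(M : ℝ)⁻¹ * (∑ i ∈ Finset.range M, μ.real (Y ∩ S^[i] ⁻¹' (A j))) - μ.real (Y ∩ A j)|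
      ≤ η / 2 := by
    have e : (M : ℝ)⁻¹ * (∑ i ∈ Finset.range M, μ.real (Y ∩ S^[i] ⁻¹' (A j))) - μ.real (Y ∩ A j)
      = (M : ℝ)⁻¹ * (∑ i ∈ Finset.range M, (μ.real (Y ∩ S^[i] ⁻¹' (A j)) - μ.real (Y ∩ A j))) := by
      rw [Finset.sum_sub_distrib, mul_sub]
      simp [hMr.ne']
    rw [e, abs_mul, abs_of_pos (inv_pos.2 hMr)]
    calc _ ≤ (M : ℝ)⁻¹ * (∑ i ∈ Finset.range M, (M * (η / (2 * M)))) := by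
          gcongr
          refine (Finset.abs_sum_le_sum_abs _ _).trans (Finset.sum_le_sum fun i hi => ?_)
          refine (almost_inv_inter hmp hY hY3 i (hA j)).trans ?_
          gcongr
          exact (Finset.mem_range.1 hi).le
      _ = η / 2 := by
          simp; field_simp
  rw [abs_le] at *
  constructor <;> linarith [h2.1, h2.2, h3.1, h3.2]
lemma exists_swap_equiv {X : Type*} [MeasurableSpace X] {μ : Measure X}
    {J : Type*} [Countable J] (s : J ≃ J) (hs : ∀ j, s (s j) = j) (D : J → Set X)
    (hD : ∀ j, MeasurableSet (D j)) (hdis : ∀ i j x, x ∈ D i → x ∈ D j → i = j)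
    (g : J → X → X) (hg : ∀ j, MeasurePreserving (g j) μ μ)
    (hgD : ∀ j x, x ∈ D j → g j x ∈ D (s j)) (hgg : ∀ j x, g (s j) (g j x) = x) :
    ∃ σ : X ≃ᵐ X, MeasurePreserving σ μ μ ∧ (∀ x, σ (σ x) = x) ∧
      (∀ j x, x ∈ D j → σ x = g j x) ∧ (∀ x, (∀ j, x ∉ D j) → σ x = x) := by
  classical
  let f : X → X := fun x => if h : ∃ j, x ∈ D j then g h.choose x else x
  have hf1 : ∀ j x, x ∈ D j → f x = g j x := by
    intro j x hx
    have h : ∃ j, x ∈ D j := ⟨j, hx⟩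
    have : h.choose = j := hdis _ _ x h.choose_spec hx
    simp only [f, dif_pos h, this]
  have hf2 : ∀ x, (∀ j, x ∉ D j) → f x = x := by
    intro x hx
    have h : ¬ ∃ j, x ∈ D j := by simpa using hx
    simp only [f, dif_neg h]
  have hff : ∀ x, f (f x) = x := by
    intro x
    by_cases h : ∃ j, x ∈ D j
    · obtain ⟨j, hj⟩ := h
      rw [hf1 j x hj, hf1 (s j) _ (hgD j x hj), hgg]
    · have h' : ∀ j, x ∉ D j := by simpa using h
      rw [hf2 x h', hf2 x h']
  have hDU : MeasurableSet (⋃ j, D j) := MeasurableSet.iUnion hD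
  have hpre : ∀ B : Set X, f ⁻¹' B = (⋃ j, (D j ∩ g j ⁻¹' B)) ∪ ((⋃ j, D j)ᶜ ∩ B) := by
    intro B
    ext x
    by_cases h : ∃ j, x ∈ D j
    · obtain ⟨j, hj⟩ := h
      simp only [Set.mem_preimage, hf1 j x hj, Set.mem_union, Set.mem_iUnion, Set.mem_inter_iff,
        Set.mem_compl_iff]
      constructor
      · intro hx; exact Or.inl ⟨j, hj, hx⟩
      · rintro (⟨i, hi, hx⟩ | ⟨h1, _⟩)
        · rwa [hdis _ _ x hj hi]
        · exact absurd ⟨j, hj⟩ h1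
    · have h' : ∀ j, x ∉ D j := by simpa using h
      simp [hf2 x h', h']
  have hfm : Measurable f := by
    intro B hB
    rw [hpre]
    exact (MeasurableSet.iUnion fun j => (hD j).inter ((hg j).measurable hB)).union
      (hDU.compl.inter hB)
  have hdec : ∀ B : Set X, MeasurableSet B → μ B = (∑' j, μ (B ∩ D j)) + μ (B \ ⋃ j, D j) := by
    intro B hB
    rw [← measure_inter_add_sdiff B hDU, Set.inter_iUnion, measure_iUnion]
    · intro i j hij
      refine Set.disjoint_left.2 fun x hx hx' => hij (hdis _ _ x hx.2 hx'.2)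
    · exact fun j => hB.inter (hD j)
  have hmp : MeasurePreserving f μ μ := by
    refine ⟨hfm, Measure.ext fun B hB => ?_⟩
    rw [Measure.map_apply hfm hB, hdec _ (hfm hB), hdec B hB]
    congr 1
    · rw [← s.tsum_eq (fun j => μ (B ∩ D j))]
      refine tsum_congr fun j => ?_
      rw [← (hg j).measure_preimage (hB.inter (hD (s j))).nullMeasurableSet]
      congr 1
      ext x
      constructor
      · rintro ⟨h1, h2⟩
        refine ⟨?_, hgD j x h2⟩
        rw [Set.mem_preimage, hf1 j x h2] at h1
        exact h1
      · rintro ⟨h1, h2⟩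
        have h3 : x ∈ D j := by
          have := hgD _ _ h2
          rwa [hgg, hs] at this
        refine ⟨?_, h3⟩
        rw [Set.mem_preimage, hf1 j x h3]
        exact h1
    · congr 1
      ext x
      constructor
      · rintro ⟨h1, h2⟩
        refine ⟨?_, h2⟩
        rwa [Set.mem_preimage, hf2 x (by simpa using h2)] at h1
      · rintro ⟨h1, h2⟩
        refine ⟨?_, h2⟩
        rwa [Set.mem_preimage, hf2 x (by simpa using h2)]
  exact ⟨⟨⟨f, f, hff, hff⟩, hfm, hfm⟩, hmp, hff, hf1, hf2⟩

/-- Greedy matching: matched points of `P` and of `Q` before stage `k`. -/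
def greedyUsed {X ι : Type*} (f g : X → X) (a : X → ι) (P Q : Set X) : ℕ → Set X × Set X
  | 0 => (∅, ∅)
  | k + 1 =>
    ((greedyUsed f g a P Q k).1 ∪ {x | x ∈ P ∧ x ∉ (greedyUsed f g a P Q k).1 ∧ f^[k] x ∈ Q ∧
        f^[k] x ∉ (greedyUsed f g a P Q k).2 ∧ a (f^[k] x) = a x},
     (greedyUsed f g a P Q k).2 ∪ g^[k] ⁻¹' {x | x ∈ P ∧ x ∉ (greedyUsed f g a P Q k).1 ∧
        f^[k] x ∈ Q ∧ f^[k] x ∉ (greedyUsed f g a P Q k).2 ∧ a (f^[k] x) = a x})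

lemma exists_greedy_swap {X : Type*} [MeasurableSpace X] {μ : Measure X} [IsProbabilityMeasure μ]
    (S : X ≃ᵐ X) (hS : Ergodic S μ) {ι : Type*} [Countable ι] [MeasurableSpace ι]
    [MeasurableSingletonClass ι]
    {a : X → ι} (ha : Measurable a) {C Y : Set X} (hC : MeasurableSet C) (hY : MeasurableSet Y) :
    ∃ σ : X ≃ᵐ X, MeasurePreserving σ μ μ ∧ (∀ x, σ (σ x) = x) ∧ (∀ x, a (σ x) = a x) ∧
      ∀ j, min (μ.real (C ∩ a ⁻¹' {j})) (μ.real (Y ∩ a ⁻¹' {j})) ≤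
        μ.real (Y ∩ a ⁻¹' {j} ∩ σ ⁻¹' C) := by
  have hmp := hS.toMeasurePreserving
  have hmps : MeasurePreserving S.symm μ μ := hmp.symm
  set P := C \ Y with hP
  set Q := Y \ C with hQ
  have hPm : MeasurableSet P := hC.diff hY
  have hQm : MeasurableSet Q := hY.diff hC
  set G := greedyUsed S S.symm a P Q with hG
  let W : ℕ → Set X := fun k => {x | x ∈ P ∧ x ∉ (G k).1 ∧ S^[k] x ∈ Q ∧
        S^[k] x ∉ (G k).2 ∧ a (S^[k] x) = a x}
  have hG1 : ∀ k, (G (k + 1)).1 = (G k).1 ∪ W k := fun k => rfl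
  have hG2 : ∀ k, (G (k + 1)).2 = (G k).2 ∪ S.symm^[k] ⁻¹' W k := fun k => rfl
  have hfg : ∀ k x, S^[k] (S.symm^[k] x) = x := fun k =>
    (Function.LeftInverse.iterate (g := S) (f := S.symm) S.apply_symm_apply k)
  have hgf : ∀ k x, S.symm^[k] (S^[k] x) = x := fun k =>
    (Function.LeftInverse.iterate (g := S.symm) (f := S) S.symm_apply_apply k)
  have hWm' : ∀ k, MeasurableSet (G k).1 → MeasurableSet (G k).2 → MeasurableSet (W k) := by
    intro k h1 h2
    have hk := (hmp.iterate k).measurable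
    have h3 : MeasurableSet {x | a (S^[k] x) = a x} := measurableSet_eq_fun (ha.comp hk) ha
    exact hPm.inter (h1.compl.inter ((hk hQm).inter ((hk h2.compl).inter h3)))
  have hGm : ∀ k, MeasurableSet (G k).1 ∧ MeasurableSet (G k).2 := by
    intro k
    induction k with
    | zero => exact ⟨MeasurableSet.empty, MeasurableSet.empty⟩
    | succ k ih =>
      rw [hG1, hG2]
      have hW := hWm' k ih.1 ih.2
      exact ⟨ih.1.union hW, ih.2.union ((hmps.iterate k).measurable hW)⟩
  have hWm : ∀ k, MeasurableSet (W k) := fun k => hWm' k (hGm k).1 (hGm k).2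
  have hGW1 : ∀ k x, x ∈ (G k).1 ↔ ∃ i < k, x ∈ W i := by
    intro k x
    induction k with
    | zero => simp [hG, greedyUsed]
    | succ k ih =>
      rw [hG1, Set.mem_union, ih]
      constructor
      · rintro (⟨i, hi, h⟩ | h)
        · exact ⟨i, by omega, h⟩
        · exact ⟨k, by omega, h⟩
      · rintro ⟨i, hi, h⟩
        rcases Nat.lt_succ_iff_lt_or_eq.1 hi with h' | rfl
        · exact Or.inl ⟨i, h', h⟩
        · exact Or.inr h
  have hGW2 : ∀ k x, x ∈ (G k).2 ↔ ∃ i < k, S.symm^[i] x ∈ W i := by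
    intro k x
    induction k with
    | zero => simp [hG, greedyUsed]
    | succ k ih =>
      rw [hG2, Set.mem_union, ih]
      constructor
      · rintro (⟨i, hi, h⟩ | h)
        · exact ⟨i, by omega, h⟩
        · exact ⟨k, by omega, h⟩
      · rintro ⟨i, hi, h⟩
        rcases Nat.lt_succ_iff_lt_or_eq.1 hi with h' | rfl
        · exact Or.inl ⟨i, h', h⟩
        · exact Or.inr h
  have hW1 : ∀ i j x, x ∈ W i → x ∈ W j → i = j := by
    intro i j x hi hj
    rcases lt_trichotomy i j with h | h | h
    · exact absurd ((hGW1 j x).2 ⟨i, h, hi⟩) hj.2.1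
    · exact h
    · exact absurd ((hGW1 i x).2 ⟨j, h, hj⟩) hi.2.1
  have hW2 : ∀ i j x, S.symm^[i] x ∈ W i → S.symm^[j] x ∈ W j → i = j := by
    intro i j x hi hj
    rcases lt_trichotomy i j with h | h | h
    · refine absurd ((hGW2 j x).2 ⟨i, h, hi⟩) ?_
      have := hj.2.2.2.1
      rwa [hfg] at this
    · exact h
    · refine absurd ((hGW2 i x).2 ⟨j, h, hj⟩) ?_
      have := hi.2.2.2.1
      rwa [hfg] at this
  have hVQ : ∀ k x, S.symm^[k] x ∈ W k → x ∈ Q := by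
    intro k x h
    have := h.2.2.1
    rwa [hfg] at this
  obtain ⟨σ, hσ, hσσ, hσ1, hσ2⟩ := exists_swap_equiv (μ := μ) (J := ℕ ⊕ ℕ) (Equiv.sumComm ℕ ℕ)
    (by rintro (j | j) <;> rfl)
    (Sum.elim W fun k => S.symm^[k] ⁻¹' W k)
    (by
      rintro (j | j)
      · exact hWm j
      · exact (hmps.iterate j).measurable (hWm j))
    (by
      rintro (i | i) (j | j) x hi hj
      · rw [hW1 i j x hi hj]
      · exact absurd hi.1.1 (hVQ j x hj).2
      · exact absurd hj.1.1 (hVQ i x hi).2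
      · rw [hW2 i j x hi hj])
    (Sum.elim (fun k => S^[k]) (fun k => S.symm^[k]))
    (by
      rintro (j | j)
      · exact hmp.iterate j
      · exact hmps.iterate j)
    (by
      rintro (j | j) x hx
      · change S.symm^[j] (S^[j] x) ∈ W j
        rw [hgf]; exact hx
      · exact hx)
    (by
      rintro (j | j) x
      · exact hgf j x
      · exact hfg j x)
  have hσW : ∀ k x, x ∈ W k → σ x = S^[k] x := fun k x h => hσ1 (Sum.inl k) x h
  have hσV : ∀ k x, S.symm^[k] x ∈ W k → σ x = S.symm^[k] x := fun k x h => hσ1 (Sum.inr k) x h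
  have hσi : ∀ x, (∀ k, x ∉ W k) → (∀ k, S.symm^[k] x ∉ W k) → σ x = x := fun x h1 h2 =>
    hσ2 x (by rintro (k | k); exacts [h1 k, h2 k])
  have haσ : ∀ x, a (σ x) = a x := by
    intro x
    by_cases h1 : ∃ k, x ∈ W k
    · obtain ⟨k, hk⟩ := h1
      rw [hσW k x hk]; exact hk.2.2.2.2
    by_cases h2 : ∃ k, S.symm^[k] x ∈ W k
    · obtain ⟨k, hk⟩ := h2
      rw [hσV k x hk]
      have := hk.2.2.2.2
      rw [hfg] at this
      exact this.symm
    · rw [hσi x (by simpa using h1) (by simpa using h2)]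
  have hσYC : ∀ x, (x ∈ C ↔ x ∈ Y) → σ x = x := by
    intro x hx
    refine hσi x (fun k hk => hk.1.2 (hx.1 hk.1.1)) (fun k hk => ?_)
    have := hVQ k x hk
    exact this.2 (hx.2 this.1)
  refine ⟨σ, hσ, hσσ, haσ, fun j => ?_⟩
  have hAm : MeasurableSet (a ⁻¹' {j}) := ha (measurableSet_singleton j)
  let Q' : Set X := {x | x ∈ Q ∧ a x = j ∧ ∀ k, S.symm^[k] x ∉ W k}
  have hQ'm : MeasurableSet Q' := by
    have : Q' = Q ∩ (a ⁻¹' {j} ∩ ⋂ k, (S.symm^[k] ⁻¹' W k)ᶜ) := by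
      ext x; simp [Q']; tauto
    rw [this]
    exact hQm.inter (hAm.inter (MeasurableSet.iInter fun k =>
      ((hmps.iterate k).measurable (hWm k)).compl))
  by_cases hQ0 : μ Q' = 0
  · refine (min_le_right _ _).trans ?_
    simp only [measureReal_def]
    refine ENNReal.toReal_mono (measure_ne_top _ _) (measure_mono_ae ?_)
    have : ∀ᵐ x ∂μ, x ∉ Q' := by rw [ae_iff]; simpa using hQ0
    filter_upwards [this] with x hx hx2
    refine ⟨hx2, ?_⟩
    change σ x ∈ C
    by_cases hxC : x ∈ C
    · rw [hσYC x ⟨fun _ => hx2.1, fun _ => hxC⟩]; exact hxC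
    · have : ∃ k, S.symm^[k] x ∈ W k := by
        by_contra hcon
        push Not at hcon
        exact hx ⟨⟨hx2.1, hxC⟩, hx2.2, hcon⟩
      obtain ⟨k, hk⟩ := this
      rw [hσV k x hk]
      exact hk.1.1
  · refine (min_le_left _ _).trans ?_
    have h1 : μ.real (Y ∩ a ⁻¹' {j} ∩ σ ⁻¹' C) =
        μ.real (σ ⁻¹' (Y ∩ a ⁻¹' {j} ∩ σ ⁻¹' C)) := by
      simp only [measureReal_def]
      rw [hσ.measure_preimage ((hY.inter hAm).inter (σ.measurable hC)).nullMeasurableSet]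
    rw [h1]
    simp only [measureReal_def]
    refine ENNReal.toReal_mono (measure_ne_top _ _) (measure_mono_ae ?_)
    filter_upwards [ergodic_sweep hS hQ'm hQ0] with x hx hx2
    refine ⟨⟨?_, ?_⟩, ?_⟩
    · by_cases hxY : x ∈ Y
      · rw [hσYC x ⟨fun _ => hxY, fun _ => hx2.1⟩]; exact hxY
      · have : ∃ k, x ∈ W k := by
          by_contra hcon
          push Not at hcon
          obtain ⟨k, hk⟩ := hx
          refine hcon k ⟨⟨hx2.1, hxY⟩, ?_, hk.1, ?_, hk.2.1.trans ?_⟩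
          · rw [hGW1]; rintro ⟨i, _, hi⟩; exact hcon i hi
          · rw [hGW2]; rintro ⟨i, _, hi⟩; exact hk.2.2 i hi
          · exact (show a x = j from hx2.2).symm
        obtain ⟨k, hk⟩ := this
        rw [hσW k x hk]
        exact hk.2.2.1.1
    · change a (σ x) = j
      rw [haσ]; exact hx2.2
    · change σ (σ x) ∈ C
      rw [hσσ]; exact hx2.1
lemma gibbs_ineq {ι : Type*} [Fintype ι] (p q : ι → ℝ) (hp : ∀ i, 0 ≤ p i) (hq : ∀ i, 0 < q i)
    (h : ∑ i, q i ≤ ∑ i, p i) :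
    ∑ i, -(p i * Real.logb 2 (p i)) ≤ ∑ i, p i * -Real.logb 2 (q i) := by
  have hl2 : 0 < Real.log 2 := Real.log_pos (by norm_num)
  have key : ∀ i, -(p i * Real.logb 2 (p i)) ≤
      p i * -Real.logb 2 (q i) + (q i - p i) / Real.log 2 := by
    intro i
    rcases (hp i).eq_or_lt with h0 | h0
    · rw [← h0]
      have : 0 ≤ q i / Real.log 2 := div_nonneg (hq i).le hl2.le
      simpa using this
    · have h1 : Real.log (q i / p i) ≤ q i / p i - 1 := Real.log_le_sub_one_of_pos (div_pos (hq i) h0)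
      rw [Real.log_div (hq i).ne' h0.ne'] at h1
      have h2 : p i * (Real.log (q i) - Real.log (p i)) ≤ q i - p i := by
        calc _ ≤ p i * (q i / p i - 1) := by gcongr
          _ = _ := by field_simp
      have h3 : p i * -Real.logb 2 (q i) + (q i - p i) / Real.log 2 - -(p i * Real.logb 2 (p i))
          = ((q i - p i) - p i * (Real.log (q i) - Real.log (p i))) / Real.log 2 := by
        simp only [Real.logb]; field_simp; ring
      have h4 : 0 ≤ ((q i - p i) - p i * (Real.log (q i) - Real.log (p i))) / Real.log 2 :=
        div_nonneg (by linarith) hl2.le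
      linarith
  calc _ ≤ ∑ i, (p i * -Real.logb 2 (q i) + (q i - p i) / Real.log 2) :=
        Finset.sum_le_sum fun i _ => key i
    _ = ∑ i, p i * -Real.logb 2 (q i) + (∑ i, q i - ∑ i, p i) / Real.log 2 := by
        rw [Finset.sum_add_distrib, ← Finset.sum_div, Finset.sum_sub_distrib]
    _ ≤ _ := by
        have : (∑ i, q i - ∑ i, p i) / Real.log 2 ≤ 0 :=
          div_nonpos_of_nonpos_of_nonneg (by linarith) hl2.le
        linarith

lemma joinEntropy_nonneg {X : Type*} [MeasurableSpace X] (μ : Measure X) [IsProbabilityMeasure μ]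
    {n : ℕ} (C : Fin n → Set X) : 0 ≤ joinEntropy μ C := by
  refine Finset.sum_nonneg fun s _ => ?_
  rw [neg_nonneg]
  refine mul_nonpos_of_nonneg_of_nonpos ENNReal.toReal_nonneg ?_
  exact Real.logb_nonpos (by norm_num) ENNReal.toReal_nonneg measureReal_le_one

lemma measureReal_eq_sum_fibers {X ι : Type*} [MeasurableSpace X] {μ : Measure X}
    [IsProbabilityMeasure μ]
    [Fintype ι] [MeasurableSpace ι] [MeasurableSingletonClass ι] {a : X → ι} (ha : Measurable a)
    {B : Set X} (hB : MeasurableSet B) : μ.real B = ∑ j, μ.real (B ∩ a ⁻¹' {j}) := by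
  rw [← measureReal_iUnion_fintype]
  · congr 1
    ext x; simp
  · intro i j hij
    refine Set.disjoint_left.2 fun x hx hx' => hij ?_
    exact (show a x = i from hx.2).symm.trans hx'.2
  · exact fun j => hB.inter (ha (measurableSet_singleton j))

lemma joinEntropy_le {X ι : Type*} [MeasurableSpace X] {μ : Measure X} [IsProbabilityMeasure μ]
    [Fintype ι] [Nonempty ι] [MeasurableSpace ι] [MeasurableSingletonClass ι] {a : X → ι}
    (ha : Measurable a) {δ : ℝ} (hδ : 0 < δ) (hδ1 : δ < 1) {n : ℕ} (C : Fin n → Set X)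
    (hC : ∀ i, MeasurableSet (C i))
    (h : ∀ i, ∑ j, min (μ.real (C i ∩ a ⁻¹' {j})) (μ.real (a ⁻¹' {j} \ C i)) ≤ δ) :
    joinEntropy μ C ≤ Real.logb 2 (Fintype.card ι) +
      n * (-Real.logb 2 (1 - δ) + -Real.logb 2 δ * δ) := by
  classical
  have hA : ∀ j, MeasurableSet (a ⁻¹' {j}) := fun j => ha (measurableSet_singleton j)
  let d : Fin n → ι → Bool := fun i j =>
    decide (μ.real (a ⁻¹' {j} \ C i) < μ.real (C i ∩ a ⁻¹' {j}))
  let w : Fin n → ι → Bool → ℝ := fun i j v => if v = d i j then 1 - δ else δ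
  have hw0 : ∀ i j v, 0 < w i j v := by
    intro i j v
    simp only [w]; split_ifs <;> linarith
  have hw1 : ∀ i j, ∑ v, w i j v = 1 := by
    intro i j
    rw [Fintype.sum_bool]
    simp only [w]
    cases d i j <;> simp
  have hcard : (0 : ℝ) < Fintype.card ι := by exact_mod_cast Fintype.card_pos
  let q : (Fin n → Bool) → ℝ := fun s => (Fintype.card ι : ℝ)⁻¹ * ∑ j, ∏ i, w i j (s i)
  have hqpos : ∀ s, 0 < q s := fun s => mul_pos (inv_pos.2 hcard)
    (Finset.sum_pos (fun j _ => Finset.prod_pos fun i _ => hw0 i j _) Finset.univ_nonempty)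
  have hqsum : ∑ s, q s = 1 := by
    simp only [q]
    rw [← Finset.mul_sum, Finset.sum_comm]
    have : ∀ j, ∑ s : Fin n → Bool, ∏ i, w i j (s i) = 1 := by
      intro j
      have := Finset.prod_univ_sum (fun _ : Fin n => (Finset.univ : Finset Bool))
        (fun i v => w i j v)
      rw [Fintype.piFinset_univ] at this
      rw [← this]
      exact Finset.prod_eq_one fun i _ => hw1 i j
    simp only [this]
    simp [hcard.ne']
  let code : X → (Fin n → Bool) := fun x i => decide (x ∈ C i)
  have hcode : Measurable code := by
    refine measurable_pi_lambda _ fun i => ?_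
    refine measurable_to_bool ?_
    have : (fun x => code x i) ⁻¹' {true} = C i := by ext x; simp [code]
    rw [this]; exact hC i
  have hcell : ∀ s : Fin n → Bool, (⋂ i, if s i then C i else (C i)ᶜ) = code ⁻¹' {s} := by
    intro s
    ext x
    simp only [Set.mem_iInter, Set.mem_preimage, Set.mem_singleton_iff, funext_iff, code]
    refine forall_congr' fun i => ?_
    cases hs : s i <;> simp
  let p : (Fin n → Bool) → ℝ := fun s => μ.real (code ⁻¹' {s})
  have hpsum : ∑ s, p s = 1 := by
    have := measureReal_eq_sum_fibers (μ := μ) hcode MeasurableSet.univ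
    simp only [Set.univ_inter, probReal_univ] at this
    exact this.symm
  have hjoin : joinEntropy μ C = ∑ s, -(p s * Real.logb 2 (p s)) := by
    simp only [joinEntropy, hcell]; rfl
  have hint : ∑ s, p s * -Real.logb 2 (q s) = ∫ x, -Real.logb 2 (q (code x)) ∂μ := by
    rw [← integral_map (φ := code) (f := fun s => -Real.logb 2 (q s)) hcode.aemeasurable
      (by
        apply Measurable.aestronglyMeasurable
        exact measurable_of_finite _)]
    have : IsProbabilityMeasure (μ.map code) := Measure.isProbabilityMeasure_map hcode.aemeasurable
    rw [integral_fintype (Integrable.of_finite)]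
    refine Finset.sum_congr rfl fun s _ => ?_
    rw [map_measureReal_apply hcode (measurableSet_singleton s), smul_eq_mul]
  let B : Fin n → Set X := fun i => {x | code x i ≠ d i (a x)}
  have hBm : ∀ i, MeasurableSet (B i) := by
    intro i
    have h1 : Measurable fun x => code x i := (measurable_pi_apply i).comp hcode
    have h2 : Measurable fun x => d i (a x) := (measurable_of_finite (d i)).comp ha
    exact (measurableSet_eq_fun h1 h2).compl
  have hBδ : ∀ i, μ.real (B i) ≤ δ := by
    intro i
    refine le_trans (le_of_eq ?_) (h i)
    rw [measureReal_eq_sum_fibers ha (hBm i)]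
    refine Finset.sum_congr rfl fun j _ => ?_
    by_cases hj : μ.real (a ⁻¹' {j} \ C i) < μ.real (C i ∩ a ⁻¹' {j})
    · rw [min_eq_right hj.le]
      congr 1
      ext x
      simp only [B, d, code, Set.mem_inter_iff, Set.mem_ofPred_eq, Set.mem_preimage,
        Set.mem_singleton_iff, Set.mem_sdiff]
      constructor
      · rintro ⟨h1, rfl⟩
        simp [hj] at h1
        exact ⟨rfl, h1⟩
      · rintro ⟨rfl, h1⟩
        simp [hj, h1]
    · rw [min_eq_left (not_lt.1 hj)]
      congr 1
      ext x
      simp only [B, d, code, Set.mem_inter_iff, Set.mem_ofPred_eq, Set.mem_preimage,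
        Set.mem_singleton_iff]
      constructor
      · rintro ⟨h1, rfl⟩
        simp [hj] at h1
        exact ⟨h1, rfl⟩
      · rintro ⟨h1, rfl⟩
        simp [hj, h1]
  have hα : 0 ≤ -Real.logb 2 (1 - δ) := by
    rw [neg_nonneg]; exact Real.logb_nonpos (by norm_num) (by linarith) (by linarith)
  have hβ : 0 ≤ -Real.logb 2 δ := by
    rw [neg_nonneg]; exact Real.logb_nonpos (by norm_num) hδ.le hδ1.le
  let K : X → ℝ := fun x => Real.logb 2 (Fintype.card ι) + ∑ i, (-Real.logb 2 (1 - δ) +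
    (B i).indicator (fun _ => -Real.logb 2 δ) x)
  have hK : ∀ x, -Real.logb 2 (q (code x)) ≤ K x := by
    intro x
    have h1 : (Fintype.card ι : ℝ)⁻¹ * ∏ i, w i (a x) (code x i) ≤ q (code x) := by
      refine mul_le_mul_of_nonneg_left ?_ (inv_pos.2 hcard).le
      exact Finset.single_le_sum (f := fun j => ∏ i, w i j (code x i))
        (fun j _ => Finset.prod_nonneg fun i _ => (hw0 i j _).le) (Finset.mem_univ (a x))
    have hpr : 0 < ∏ i, w i (a x) (code x i) := Finset.prod_pos fun i _ => hw0 i _ _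
    have h2 := Real.logb_le_logb_of_le (b := 2) (by norm_num) (mul_pos (inv_pos.2 hcard) hpr) h1
    rw [Real.logb_mul (inv_pos.2 hcard).ne' hpr.ne', Real.logb_inv] at h2
    have h3 : Real.logb 2 (∏ i, w i (a x) (code x i)) = ∑ i, Real.logb 2 (w i (a x) (code x i)) := by
      simp only [Real.logb]
      rw [Real.log_prod (fun i _ => (hw0 i _ _).ne'), Finset.sum_div]
    rw [h3] at h2
    have h4 : ∑ i, -Real.logb 2 (w i (a x) (code x i)) ≤ ∑ i, (-Real.logb 2 (1 - δ) +
        (B i).indicator (fun _ => -Real.logb 2 δ) x) := by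
      refine Finset.sum_le_sum fun i _ => ?_
      by_cases hx : code x i = d i (a x)
      · have : x ∉ B i := by simpa [B] using hx
        simp [this, w, hx]
      · have : x ∈ B i := hx
        rw [Set.indicator_of_mem this]
        simp only [w, if_neg hx]
        linarith
    rw [Finset.sum_neg_distrib] at h4
    simp only [K]
    linarith
  have hindint : ∀ i, Integrable ((B i).indicator (fun _ => -Real.logb 2 δ)) μ := fun i =>
    (integrable_const _).indicator (hBm i)
  have hterm : ∀ i, Integrable (fun x => -Real.logb 2 (1 - δ) +
      (B i).indicator (fun _ => -Real.logb 2 δ) x) μ := fun i =>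
    (integrable_const _).add (hindint i)
  have hsumint : Integrable (fun x => ∑ i, (-Real.logb 2 (1 - δ) +
    (B i).indicator (fun _ => -Real.logb 2 δ) x)) μ :=
      integrable_finsetSum _ fun i _ => hterm i
  have hKint : Integrable K μ := (integrable_const _).add hsumint
  have hintK : ∫ x, K x ∂μ ≤ Real.logb 2 (Fintype.card ι) +
      n * (-Real.logb 2 (1 - δ) + -Real.logb 2 δ * δ) := by
    simp only [K]
    rw [integral_add (integrable_const _) hsumint, integral_finsetSum _
      (fun i _ => hterm i)]
    have : ∀ i, ∫ x, (-Real.logb 2 (1 - δ) + (B i).indicator (fun _ => -Real.logb 2 δ) x) ∂μ ≤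
        (-Real.logb 2 (1 - δ) + -Real.logb 2 δ * δ) := by
      intro i
      rw [integral_add (integrable_const _) (hindint i), integral_indicator_const _ (hBm i)]
      simp only [integral_const, probReal_univ, smul_eq_mul, one_mul]
      have := mul_le_mul_of_nonneg_left (hBδ i) hβ
      linarith
    have h5 := Finset.sum_le_sum fun i (_ : i ∈ (Finset.univ : Finset (Fin n))) => this i
    simp only [Finset.sum_const, Finset.card_univ, Fintype.card_fin, nsmul_eq_mul] at h5
    simp only [integral_const, probReal_univ, smul_eq_mul, one_mul]
    linarith
  have hLint : Integrable (fun x => -Real.logb 2 (q (code x))) μ := by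
    have : Integrable (fun s => -Real.logb 2 (q s)) (μ.map code) := by
      have : IsProbabilityMeasure (μ.map code) :=
        Measure.isProbabilityMeasure_map hcode.aemeasurable
      exact Integrable.of_finite
    exact this.comp_measurable hcode
  calc joinEntropy μ C = _ := hjoin
    _ ≤ _ := gibbs_ineq p q (fun s => measureReal_nonneg) hqpos (by rw [hqsum, hpsum])
    _ = _ := hint
    _ ≤ ∫ x, K x ∂μ := integral_mono hLint hKint hK
    _ ≤ _ := hintK

lemma exists_split {X : Type*} [MeasurableSpace X] {μ : Measure X} [IsProbabilityMeasure μ]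
    {𝒞 : Set (Set X)} (h𝒞 : ∀ C ∈ 𝒞, MeasurableSet C) (hent : 0 < famEntropy μ 𝒞) :
    ∃ δ : ℝ, 0 < δ ∧ ∀ (ι : Type) [Fintype ι] [MeasurableSpace ι] [MeasurableSingletonClass ι]
      (a : X → ι), Measurable a → ∃ C ∈ 𝒞,
        δ < ∑ j, min (μ.real (C ∩ a ⁻¹' {j})) (μ.real (a ⁻¹' {j} \ C)) := by
  by_contra hcon
  push Not at hcon
  have hcont : Tendsto (fun δ : ℝ => -Real.logb 2 (1 - δ) + -Real.logb 2 δ * δ)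
      (nhdsWithin 0 (Set.Ioi 0)) (nhds 0) := by
    have h1 : ContinuousAt (fun δ : ℝ => -(Real.log (1 - δ) / Real.log 2)) 0 := by
      refine ((ContinuousAt.log ?_ ?_).div_const _).neg
      · fun_prop
      · norm_num
    have h2 : ContinuousAt (fun δ : ℝ => -((δ * Real.log δ) / Real.log 2)) 0 :=
      (Real.continuous_mul_log.continuousAt.div_const _).neg
    have h3 := (h1.add h2).tendsto.mono_left (nhdsWithin_le_nhds (s := Set.Ioi (0 : ℝ)))
    have e : (fun δ : ℝ => -Real.logb 2 (1 - δ) + -Real.logb 2 δ * δ) =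
      fun δ : ℝ => -(Real.log (1 - δ) / Real.log 2) + -((δ * Real.log δ) / Real.log 2) := by
      funext δ; simp only [Real.logb]; ring
    rw [e]
    have h4 : -(Real.log (1 - (0 : ℝ)) / Real.log 2) + -(((0 : ℝ) * Real.log 0) / Real.log 2) = 0 := by
      simp
    have h5 : Tendsto (fun δ : ℝ => -(Real.log (1 - δ) / Real.log 2) +
        -((δ * Real.log δ) / Real.log 2)) (nhdsWithin 0 (Set.Ioi 0))
        (nhds (-(Real.log (1 - (0 : ℝ)) / Real.log 2) +
          -(((0 : ℝ) * Real.log 0) / Real.log 2))) := h3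
    rwa [h4] at h5
  obtain ⟨δ, hlt, hδ0, hδ1⟩ : ∃ δ : ℝ, -Real.logb 2 (1 - δ) + -Real.logb 2 δ * δ < famEntropy μ 𝒞
      ∧ 0 < δ ∧ δ < 1 := by
    have h1 := hcont.eventually (gt_mem_nhds hent)
    have h2 : ∀ᶠ δ : ℝ in nhdsWithin 0 (Set.Ioi 0), δ ∈ Set.Ioo (0 : ℝ) 1 :=
      Ioo_mem_nhdsGT one_pos
    exact (h1.and h2).exists
  obtain ⟨ι, _, _, _, a, ha, hC⟩ := hcon δ hδ0
  have hXne : Nonempty X := nonempty_of_isProbabilityMeasure μ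
  have : Nonempty ι := hXne.map a
  have hh0 : 0 ≤ -Real.logb 2 (1 - δ) + -Real.logb 2 δ * δ := by
    have hα : 0 ≤ -Real.logb 2 (1 - δ) := by
      rw [neg_nonneg]; exact Real.logb_nonpos (by norm_num) (by linarith) (by linarith)
    have hβ : 0 ≤ -Real.logb 2 δ := by
      rw [neg_nonneg]; exact Real.logb_nonpos (by norm_num) hδ0.le hδ1.le
    positivity
  refine absurd hlt (not_lt.2 ?_)
  refine Real.iSup_le (fun S => ?_) hh0
  set hh := -Real.logb 2 (1 - δ) + -Real.logb 2 δ * δ with hhdef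
  have hv : Tendsto (fun n : ℕ => Real.logb 2 (Fintype.card ι) / (n : ℝ) + hh) atTop
      (nhds hh) := by
    simpa using (tendsto_const_div_atTop_nhds_zero_nat (Real.logb 2 (Fintype.card ι))).add_const hh
  rw [← hv.liminf_eq]
  refine liminf_le_liminf ?_ ?_ ?_
  · filter_upwards [eventually_gt_atTop 0] with n hn
    have hn' : (0 : ℝ) < n := by exact_mod_cast hn
    have := joinEntropy_le (μ := μ) ha hδ0 hδ1 (fun i : Fin n => S.1 i)
      (fun i => h𝒞 _ (S.2 i)) (fun i => hC _ (S.2 i))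
    rw [div_le_iff₀ hn', add_mul, div_mul_cancel₀ _ hn'.ne']
    linarith
  · exact isBoundedUnder_of ⟨0, fun n => div_nonneg (joinEntropy_nonneg μ _) n.cast_nonneg⟩
  · exact hv.isCoboundedUnder_ge
lemma core_deviation {X : Type*} [MeasurableSpace X] {μ : Measure X} [IsProbabilityMeasure μ]
    (S : X ≃ᵐ X) (hS : Ergodic S μ)
    (hat : ∀ ε : ℝ, 0 < ε → ∃ E : Set X, MeasurableSet E ∧ 0 < μ.real E ∧ μ.real E ≤ ε)
    {ι : Type*} [Fintype ι] [MeasurableSpace ι] [MeasurableSingletonClass ι]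
    {a : X → ι} (ha : Measurable a) {C : Set X} (hC : MeasurableSet C) {δ : ℝ} (hδ : 0 < δ)
    (hsplit : δ < ∑ j, min (μ.real (C ∩ a ⁻¹' {j})) (μ.real (a ⁻¹' {j} \ C)))
    {N : ℕ} (hN : 1 ≤ N) :
    ∃ σ : X ≃ᵐ X, MeasurePreserving σ μ μ ∧ (∀ x, σ (σ x) = x) ∧ (∀ x, a (σ x) = a x) ∧
      δ / 8 < birkDev μ (fun x => σ.symm (S (σ x))) C N := by
  have hmp := hS.toMeasurePreserving
  have hA : ∀ j, MeasurableSet (a ⁻¹' {j}) := fun j => ha (measurableSet_singleton j)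
  have hNr : (0 : ℝ) < N := by exact_mod_cast hN
  set m : ℝ := (Fintype.card ι : ℝ) with hm
  have hm0 : 0 ≤ m := Nat.cast_nonneg _
  obtain ⟨η, hη, hη1, hη2⟩ : ∃ η : ℝ, 0 < η ∧ η ≤ 1 / 4 ∧ (m + N) * η ≤ δ / 8 := by
    have hpos : 0 < δ / (8 * (m + N)) := by positivity
    refine ⟨min (1 / 4) (δ / (8 * (m + N))), lt_min (by norm_num) hpos, min_le_left _ _, ?_⟩
    calc _ ≤ (m + N) * (δ / (8 * (m + N))) := by gcongr; exact min_le_right _ _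
      _ = δ / 8 := by field_simp
  obtain ⟨Y, hY, hY1, hY2, hYA, hYS⟩ := exists_Y hS hat (fun j => a ⁻¹' {j}) hA hη
  obtain ⟨σ, hσ, hσσ, haσ, hmin⟩ := exists_greedy_swap S hS ha hC hY
  refine ⟨σ, hσ, hσσ, haσ, ?_⟩
  set D := σ ⁻¹' C with hDdef
  have hD : MeasurableSet D := σ.measurable hC
  set κ := μ.real Y with hκ
  have hYD : κ * μ.real C + δ / 4 - m * η < μ.real (Y ∩ D) := by
    rw [measureReal_eq_sum_fibers ha (hY.inter hD), measureReal_eq_sum_fibers ha hC]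
    have key : ∀ j, κ * μ.real (C ∩ a ⁻¹' {j}) +
        min (μ.real (C ∩ a ⁻¹' {j})) (μ.real (a ⁻¹' {j} \ C)) / 4 - η
          ≤ μ.real (Y ∩ D ∩ a ⁻¹' {j}) := by
      intro j
      have h1 := hmin j
      rw [Set.inter_right_comm] at h1
      refine le_trans ?_ h1
      have h2 := (abs_le.1 (hYA j)).1
      have h3 : μ.real (a ⁻¹' {j}) = μ.real (C ∩ a ⁻¹' {j}) + μ.real (a ⁻¹' {j} \ C) := by
        rw [← measureReal_inter_add_sdiff (s := a ⁻¹' {j}) hC, Set.inter_comm]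
      rw [h3] at h2
      have hc0 : 0 ≤ μ.real (C ∩ a ⁻¹' {j}) := measureReal_nonneg
      have he0 : 0 ≤ μ.real (a ⁻¹' {j} \ C) := measureReal_nonneg
      have hml := min_le_left (μ.real (C ∩ a ⁻¹' {j})) (μ.real (a ⁻¹' {j} \ C))
      have hmr := min_le_right (μ.real (C ∩ a ⁻¹' {j})) (μ.real (a ⁻¹' {j} \ C))
      apply le_min
      · nlinarith
      · nlinarith
    have h4 := Finset.sum_le_sum fun j (_ : j ∈ (Finset.univ : Finset ι)) => key j
    rw [Finset.sum_sub_distrib, Finset.sum_add_distrib, ← Finset.mul_sum, ← Finset.sum_div] at h4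
    simp only [Finset.sum_const, Finset.card_univ, nsmul_eq_mul] at h4
    linarith
  set R : X → X := fun x => σ.symm (S (σ x)) with hR
  have hRi : ∀ i x, R^[i] x = σ (S^[i] (σ x)) := by
    have hsymm : ∀ x, σ.symm x = σ x := fun x => by
      rw [MeasurableEquiv.symm_apply_eq, hσσ]
    intro i x
    induction i with
    | zero => simp [hσσ]
    | succ i ih =>
      rw [Function.iterate_succ_apply', Function.iterate_succ_apply', ih]
      simp only [hR, hsymm, hσσ]
  set Z := σ ⁻¹' Y with hZdef
  have hZ : MeasurableSet Z := σ.measurable hY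
  have hZY : μ.real Z = κ := by
    simp only [hκ, measureReal_def, hZdef]
    rw [hσ.measure_preimage hY.nullMeasurableSet]
  have hpre : ∀ i, R^[i] ⁻¹' C = σ ⁻¹' (S^[i] ⁻¹' D) := by
    intro i; ext x
    simp only [Set.mem_preimage, hRi, hDdef]
  have hpm : ∀ i, MeasurableSet (R^[i] ⁻¹' C) := fun i => by
    rw [hpre]; exact σ.measurable ((hmp.iterate i).measurable hD)
  have hmeas : ∀ i ∈ Finset.range N, μ.real (Y ∩ D) - N * η ≤ μ.real (R^[i] ⁻¹' C ∩ Z) := by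
    intro i hi
    have h1 : μ.real (R^[i] ⁻¹' C ∩ Z) = μ.real (Y ∩ S^[i] ⁻¹' D) := by
      rw [hpre, hZdef, ← Set.preimage_inter, Set.inter_comm]
      simp only [measureReal_def]
      rw [hσ.measure_preimage (hY.inter ((hmp.iterate i).measurable hD)).nullMeasurableSet]
    have h2 := (abs_le.1 (almost_inv_inter hmp hY hYS i hD)).1
    have h3 : (i : ℝ) * η ≤ N * η := by
      gcongr; exact (Finset.mem_range.1 hi).le
    rw [h1]; linarith
  have hind : ∀ i, Integrable ((R^[i] ⁻¹' C).indicator (fun _ => (1 : ℝ))) μ := fun i =>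
    (integrable_const _).indicator (hpm i)
  let F : X → ℝ := fun x => (∑ i ∈ Finset.range N, (R^[i] ⁻¹' C).indicator (fun _ => (1 : ℝ)) x) / N
    - μ.real C
  have hsum : Integrable (fun x => (∑ i ∈ Finset.range N,
      (R^[i] ⁻¹' C).indicator (fun _ => (1 : ℝ)) x) / N) μ :=
    (integrable_finsetSum _ fun i _ => hind i).div_const _
  have hF : Integrable F μ := hsum.sub (integrable_const _)
  have hdev : birkDev μ R C N = ∫ x, |F x| ∂μ := rfl
  have hFZ : ∫ x in Z, F x ∂μ =
      (∑ i ∈ Finset.range N, μ.real (R^[i] ⁻¹' C ∩ Z)) / N - κ * μ.real C := by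
    simp only [F]
    rw [integral_sub hsum.integrableOn (integrable_const _), integral_div,
      integral_finsetSum _ (fun i _ => (hind i).integrableOn)]
    congr 1
    · congr 1
      refine Finset.sum_congr rfl fun i _ => ?_
      rw [integral_indicator_const _ (hpm i), measureReal_restrict_apply (hpm i)]
      simp
    · simp [hZY]
  have h5 : μ.real (Y ∩ D) - N * η ≤ (∑ i ∈ Finset.range N, μ.real (R^[i] ⁻¹' C ∩ Z)) / N := by
    rw [le_div_iff₀ hNr]
    have := Finset.card_nsmul_le_sum _ _ _ hmeas
    rw [Finset.card_range, nsmul_eq_mul] at this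
    linarith
  have h6 : ∫ x in Z, F x ∂μ ≤ ∫ x, |F x| ∂μ := by
    calc _ ≤ ∫ x in Z, |F x| ∂μ :=
          integral_mono hF.integrableOn hF.abs.integrableOn fun x => le_abs_self _
      _ ≤ _ := setIntegral_le_integral hF.abs (Eventually.of_forall fun x => abs_nonneg _)
  rw [hdev]
  nlinarith

lemma lebesgue01_prob : IsProbabilityMeasure lebesgue01 := by
  refine ⟨?_⟩
  rw [lebesgue01, (MeasurableEmbedding.subtype_coe measurableSet_Ico).comap_apply]
  rw [Set.image_univ, Subtype.range_coe, Real.volume_Ico]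
  simp

lemma lebesgue01_small (ε : ℝ) (hε : 0 < ε) : ∃ E : Set (Set.Ico (0 : ℝ) 1), MeasurableSet E ∧
    0 < lebesgue01.real E ∧ lebesgue01.real E ≤ ε := by
  have hm : 0 < min ε 1 := lt_min hε one_pos
  have h : lebesgue01.real (Subtype.val ⁻¹' Set.Ico (0 : ℝ) (min ε 1)) = min ε 1 := by
    rw [measureReal_def, lebesgue01,
      (MeasurableEmbedding.subtype_coe measurableSet_Ico).comap_apply,
      Subtype.image_preimage_coe, Set.inter_eq_right.2]
    · rw [Real.volume_Ico, sub_zero, ENNReal.toReal_ofReal hm.le]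
    · exact Set.Ico_subset_Ico_right (min_le_right _ _)
  refine ⟨_, measurable_subtype_coe measurableSet_Ico, h ▸ hm, ?_⟩
  rw [h]; exact min_le_left _ _

lemma wdist01_le (E : ℕ → Set (Set.Ico (0 : ℝ) 1)) (φ ψ : MPE01) (I : ℕ)
    (h1 : ∀ i < I, ⇑φ.1.symm ⁻¹' E i = ⇑ψ.1.symm ⁻¹' E i)
    (h2 : ∀ i < I, ⇑φ.1 ⁻¹' E i = ⇑ψ.1 ⁻¹' E i) :
    wdist01 E φ ψ ≤ 2 * (2 : ℝ)⁻¹ ^ I := by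
  have := lebesgue01_prob
  set t : ℕ → ℝ := fun i => (2 : ℝ)⁻¹ ^ (i + 1) *
    ((lebesgue01 ((⇑φ.1.symm ⁻¹' E i) ∆ (⇑ψ.1.symm ⁻¹' E i))).toReal +
     (lebesgue01 ((⇑φ.1 ⁻¹' E i) ∆ (⇑ψ.1 ⁻¹' E i))).toReal) with ht
  have ht0 : ∀ i, 0 ≤ t i := fun i => by positivity
  have hle : ∀ i, t i ≤ (2 : ℝ)⁻¹ ^ i := by
    intro i
    have e1 : (lebesgue01 ((⇑φ.1.symm ⁻¹' E i) ∆ (⇑ψ.1.symm ⁻¹' E i))).toReal ≤ 1 :=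
      measureReal_le_one
    have e2 : (lebesgue01 ((⇑φ.1 ⁻¹' E i) ∆ (⇑ψ.1 ⁻¹' E i))).toReal ≤ 1 := measureReal_le_one
    calc t i ≤ (2 : ℝ)⁻¹ ^ (i + 1) * (1 + 1) := by simp only [ht]; gcongr
      _ = _ := by rw [pow_succ]; ring
  have hgeo : Summable (fun i : ℕ => (2 : ℝ)⁻¹ ^ i) :=
    summable_geometric_of_lt_one (by norm_num) (by norm_num)
  have hts : Summable t := Summable.of_nonneg_of_le ht0 hle hgeo
  change ∑' i, t i ≤ _
  rw [← hts.sum_add_tsum_nat_add I]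
  have hz : ∑ i ∈ Finset.range I, t i = 0 := by
    refine Finset.sum_eq_zero fun i hi => ?_
    have hi := Finset.mem_range.1 hi
    simp only [ht, h1 i hi, h2 i hi]
    simp
  rw [hz, zero_add]
  calc ∑' i, t (i + I) ≤ ∑' i : ℕ, (2 : ℝ)⁻¹ ^ I * (2 : ℝ)⁻¹ ^ i := by
        refine Summable.tsum_le_tsum (fun i => ?_) ((summable_nat_add_iff I).2 hts)
          (hgeo.mul_left _)
        refine (hle _).trans (le_of_eq ?_)
        rw [pow_add, mul_comm]
    _ = 2 * (2 : ℝ)⁻¹ ^ I := by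
        rw [tsum_mul_left, tsum_geometric_of_lt_one (by norm_num) (by norm_num)]
        norm_num [mul_comm]

/-- If `T` is an invertible ergodic measure preserving transformation of `([0,1), ℬ, μ)` and
`H_μ(𝒞) > 0`, then there is a `δ > 0` such that `G_N(T, δ)` is dense in `(Φ, d)` for every
`N ≥ 1`, where `d` is the metric attached to any sequence of measurable sets generating the
Borel σ-field. -/
theorem GN_dense_of_pos_entropy
    (T : MPE01) (hTerg : Ergodic (⇑T.1) lebesgue01)
    (𝒞 : Set (Set (Set.Ico (0 : ℝ) 1))) (h𝒞 : ∀ C ∈ 𝒞, MeasurableSet C)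
    (hent : 0 < famEntropy lebesgue01 𝒞)
    (E : ℕ → Set (Set.Ico (0 : ℝ) 1)) (hEmeas : ∀ i, MeasurableSet (E i))
    (hEgen : MeasurableSpace.generateFrom (Set.range E) =
      (inferInstance : MeasurableSpace (Set.Ico (0 : ℝ) 1))) :
    ∃ δ > (0 : ℝ), ∀ N : ℕ, 1 ≤ N →
      ∀ φ : MPE01, ∀ ε > (0 : ℝ), ∃ ψ ∈ GN01 T 𝒞 δ N, wdist01 E φ ψ < ε := by
  have := lebesgue01_prob
  obtain ⟨δ, hδ, hsplit⟩ := exists_split h𝒞 hent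
  refine ⟨δ / 8, by positivity, fun N hN φ ε hε => ?_⟩
  obtain ⟨I, hI⟩ : ∃ I : ℕ, 2 * (2 : ℝ)⁻¹ ^ I < ε := by
    obtain ⟨I, hI⟩ := exists_pow_lt_of_lt_one (half_pos hε) (by norm_num : (2 : ℝ)⁻¹ < 1)
    exact ⟨I, by linarith⟩
  classical
  let a : Set.Ico (0 : ℝ) 1 → (Fin I → Bool × Bool) := fun x i =>
    (decide (x ∈ E i), decide (φ.1 x ∈ E i))
  have ha : Measurable a := by
    refine measurable_pi_lambda _ fun i => Measurable.prodMk ?_ ?_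
    · refine measurable_to_bool ?_
      have : (fun x => decide (x ∈ E i)) ⁻¹' {true} = E i := by ext x; simp
      rw [this]; exact hEmeas i
    · refine measurable_to_bool ?_
      have : (fun x => decide (φ.1 x ∈ E i)) ⁻¹' {true} = φ.1 ⁻¹' E i := by ext x; simp
      rw [this]; exact φ.1.measurable (hEmeas i)
  obtain ⟨C, hC, hCs⟩ := hsplit _ a ha
  let S : Set.Ico (0 : ℝ) 1 ≃ᵐ Set.Ico (0 : ℝ) 1 := (φ.1.trans T.1).trans φ.1.symm
  have hS : Ergodic S lebesgue01 :=
    (MeasurePreserving.ergodic_conjugate_iff (e := φ.1.symm) (φ.2.symm φ.1)).2 hTerg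
  obtain ⟨σ, hσ, hσσ, haσ, hdev⟩ := core_deviation S hS lebesgue01_small ha (h𝒞 C hC) hδ hCs hN
  have hsymm : ∀ x, σ.symm x = σ x := fun x => by
    rw [MeasurableEquiv.symm_apply_eq, hσσ]
  refine ⟨⟨σ.trans φ.1, φ.2.comp hσ⟩, ⟨N, le_rfl, C, hC, hdev⟩, ?_⟩
  refine (wdist01_le E φ _ I ?_ ?_).trans_lt hI
  · intro i hi
    ext y
    have h := congrArg Prod.fst (congrFun (haσ (φ.1.symm y)) ⟨i, hi⟩)
    simp only [a, decide_eq_decide] at h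
    change φ.1.symm y ∈ E i ↔ σ.symm (φ.1.symm y) ∈ E i
    rw [hsymm]; exact h.symm
  · intro i hi
    ext x
    have h := congrArg Prod.snd (congrFun (haσ x) ⟨i, hi⟩)
    simp only [a, decide_eq_decide] at h
    exact h.symm
end

section
/- Let X = [0,1) with its Borel σ-field B and Lebesgue measure μ, let T be an invertible ergodic measure-preserving transformation of ([0,1), B, μ), and let C ⊆ B be a family of Borel sets. For every positive integer N and every δ > 0, the set G_N(T, δ) = {φ ∈ Φ : sup_{n ≥ N} sup_{C ∈ C} ∫ |(1/n) Σ_{i=0}^{n-1} 1_C(T_φ^i x) − μ(C)| dμ(x) > δ} is open in Φ. -/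
open MeasureTheory Filter

open scoped symmDiff

lemma gn_fin : IsFiniteMeasure lebesgue01 := by
  constructor
  unfold lebesgue01
  rw [comap_subtype_coe_apply measurableSet_Ico, Set.image_univ, Subtype.range_coe, Real.volume_Ico]
  exact ENNReal.ofReal_lt_top

lemma gn_symm (φ : MPE01) : MeasurePreserving (⇑φ.1.symm) lebesgue01 lebesgue01 :=
  MeasurePreserving.symm φ.1 φ.2

lemma gn_conj_iter (T φ : MPE01) (i : ℕ) (x : Set.Ico (0 : ℝ) 1) :
    (MPE01.conj T φ)^[i] x = φ.1.symm ((⇑T.1)^[i] (φ.1 x)) := by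
  induction i with
  | zero => simp
  | succ k ih => rw [Function.iterate_succ_apply', ih, Function.iterate_succ_apply']; simp [MPE01.conj]

lemma gn_birk_eq (T φ : MPE01) (C : Set (Set.Ico (0 : ℝ) 1)) (n : ℕ) :
    birkDev lebesgue01 (MPE01.conj T φ) C n =
      ∫ y, |(∑ i ∈ Finset.range n,
        (⇑φ.1.symm ⁻¹' C).indicator (fun _ => (1 : ℝ)) ((⇑T.1)^[i] y)) / n
          - (lebesgue01 C).toReal| ∂lebesgue01 := by
  unfold birkDev
  rw [← φ.2.integral_comp' (f := φ.1) (fun y => |(∑ i ∈ Finset.range n,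
        (⇑φ.1.symm ⁻¹' C).indicator (fun _ => (1 : ℝ)) ((⇑T.1)^[i] y)) / n
          - (lebesgue01 C).toReal|)]
  simp only [gn_conj_iter]
  rfl

noncomputable def gnD (φ ψ : MPE01) (A : Set (Set.Ico (0 : ℝ) 1)) : ℝ :=
  lebesgue01.real ((⇑φ.1.symm ⁻¹' A) ∆ (⇑ψ.1.symm ⁻¹' A))

lemma gn_ind_abs {X : Type*} (A B : Set X) (x : X) :
    |A.indicator (fun _ => (1 : ℝ)) x - B.indicator (fun _ => (1 : ℝ)) x| =
      (A ∆ B).indicator (fun _ => (1 : ℝ)) x := by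
  by_cases h1 : x ∈ A <;> by_cases h2 : x ∈ B <;> simp [h1, h2, Set.mem_symmDiff]

lemma gn_birk_le (T φ ψ : MPE01) (C : Set (Set.Ico (0 : ℝ) 1)) (hC : MeasurableSet C) (n : ℕ)
    (hn : 1 ≤ n) :
    birkDev lebesgue01 (MPE01.conj T φ) C n ≤
      birkDev lebesgue01 (MPE01.conj T ψ) C n + gnD φ ψ C := by
  have := gn_fin
  have hn0 : (0 : ℝ) < n := by exact_mod_cast hn
  set c := (lebesgue01 C).toReal with hc
  have hmeas : ∀ A : Set (Set.Ico (0 : ℝ) 1), MeasurableSet A → ∀ i : ℕ, Integrable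
      (fun y => A.indicator (fun _ => (1 : ℝ)) ((⇑T.1)^[i] y)) lebesgue01 := by
    intro A hA i
    exact ((T.2.iterate i).integrable_comp_of_integrable
      ((integrable_const (1 : ℝ)).indicator hA))
  have hI : ∀ A : Set (Set.Ico (0 : ℝ) 1), MeasurableSet A → Integrable
      (fun y => |(∑ i ∈ Finset.range n, A.indicator (fun _ => (1 : ℝ)) ((⇑T.1)^[i] y)) / n - c|)
      lebesgue01 := by
    intro A hA
    exact (((integrable_finsetSum _ fun i _ => hmeas A hA i).div_const _).sub
      (integrable_const c)).abs
  have hA := φ.1.symm.measurable hC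
  have hB := ψ.1.symm.measurable hC
  have hS := hA.symmDiff hB
  have hD : ∫ y, (∑ i ∈ Finset.range n, ((⇑φ.1.symm ⁻¹' C) ∆ (⇑ψ.1.symm ⁻¹' C)).indicator
      (fun _ => (1 : ℝ)) ((⇑T.1)^[i] y)) / n ∂lebesgue01 = gnD φ ψ C := by
    rw [integral_div, integral_finsetSum _ fun i _ => hmeas _ hS i]
    have : ∀ i ∈ Finset.range n, ∫ y, ((⇑φ.1.symm ⁻¹' C) ∆ (⇑ψ.1.symm ⁻¹' C)).indicator
      (fun _ => (1 : ℝ)) ((⇑T.1)^[i] y) ∂lebesgue01 = gnD φ ψ C := by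
      intro i _
      have h2 : (fun y => ((⇑φ.1.symm ⁻¹' C) ∆ (⇑ψ.1.symm ⁻¹' C)).indicator
          (fun _ => (1 : ℝ)) ((⇑T.1)^[i] y)) =
          ((⇑T.1)^[i] ⁻¹' ((⇑φ.1.symm ⁻¹' C) ∆ (⇑ψ.1.symm ⁻¹' C))).indicator 1 := by
        ext y; rfl
      rw [h2, integral_indicator_one ((T.2.iterate i).measurable hS), measureReal_def,
        (T.2.iterate i).measure_preimage hS.nullMeasurableSet]
      rfl
    rw [Finset.sum_congr rfl this]
    simp
    field_simp
  rw [gn_birk_eq, gn_birk_eq, ← hD, ← integral_add (hI _ hB)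
    ((integrable_finsetSum _ fun i _ => hmeas _ hS i).div_const _)]
  refine integral_mono (hI _ hA) ((hI _ hB).add
    ((integrable_finsetSum _ fun i _ => hmeas _ hS i).div_const _)) ?_
  intro y
  simp only
  rw [← hc]
  have key : |(∑ i ∈ Finset.range n, (⇑φ.1.symm ⁻¹' C).indicator (fun _ => (1 : ℝ)) ((⇑T.1)^[i] y)) -
      (∑ i ∈ Finset.range n, (⇑ψ.1.symm ⁻¹' C).indicator (fun _ => (1 : ℝ)) ((⇑T.1)^[i] y))| ≤
      ∑ i ∈ Finset.range n, ((⇑φ.1.symm ⁻¹' C) ∆ (⇑ψ.1.symm ⁻¹' C)).indicator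
      (fun _ => (1 : ℝ)) ((⇑T.1)^[i] y) := by
    rw [← Finset.sum_sub_distrib]
    refine (Finset.abs_sum_le_sum_abs _ _).trans (le_of_eq ?_)
    exact Finset.sum_congr rfl fun i _ => gn_ind_abs _ _ _
  set a := ∑ i ∈ Finset.range n, (⇑φ.1.symm ⁻¹' C).indicator (fun _ => (1 : ℝ)) ((⇑T.1)^[i] y)
  set b := ∑ i ∈ Finset.range n, (⇑ψ.1.symm ⁻¹' C).indicator (fun _ => (1 : ℝ)) ((⇑T.1)^[i] y)
  have h3 : |a / n - b / n| ≤ (∑ i ∈ Finset.range n,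
      ((⇑φ.1.symm ⁻¹' C) ∆ (⇑ψ.1.symm ⁻¹' C)).indicator
      (fun _ => (1 : ℝ)) ((⇑T.1)^[i] y)) / n := by
    rw [← sub_div, abs_div, abs_of_pos hn0]
    gcongr
  have h4 := abs_add_le (a / n - b / n) (b / n - c)
  rw [sub_add_sub_cancel] at h4
  linarith

lemma gn_gen (E : ℕ → Set (Set.Ico (0 : ℝ) 1)) (φ ψ : MPE01) (i : ℕ) :
    (2 : ℝ)⁻¹ ^ (i + 1) * gnD φ ψ (E i) ≤ wdist01 E φ ψ := by
  have := gn_fin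
  set M := lebesgue01.real Set.univ
  have hle : ∀ s : Set (Set.Ico (0 : ℝ) 1), (lebesgue01 s).toReal ≤ M := fun s =>
    measureReal_mono (Set.subset_univ s)
  have hs : Summable fun i : ℕ => (2 : ℝ)⁻¹ ^ (i + 1) *
    ((lebesgue01 ((⇑φ.1.symm ⁻¹' E i) ∆ (⇑ψ.1.symm ⁻¹' E i))).toReal +
     (lebesgue01 ((⇑φ.1 ⁻¹' E i) ∆ (⇑ψ.1 ⁻¹' E i))).toReal) := by
    have hg : Summable fun i : ℕ => (2 : ℝ)⁻¹ ^ (i + 1) * (M + M) :=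
      (((summable_nat_add_iff 1).2 (summable_geometric_of_lt_one (r := (2 : ℝ)⁻¹)
        (by norm_num) (by norm_num)))).mul_right _
    refine Summable.of_nonneg_of_le (fun i => by positivity) (fun i => ?_) hg
    gcongr <;> exact hle _
  refine le_trans ?_ (hs.le_tsum i fun j _ => by positivity)
  gcongr
  unfold gnD Measure.real
  have : 0 ≤ (lebesgue01 ((⇑φ.1 ⁻¹' E i) ∆ (⇑ψ.1 ⁻¹' E i))).toReal := ENNReal.toReal_nonneg
  exact le_add_of_nonneg_right this

lemma gn_cont (E : ℕ → Set (Set.Ico (0 : ℝ) 1)) (hEmeas : ∀ i, MeasurableSet (E i))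
    (hEgen : MeasurableSpace.generateFrom (Set.range E) =
      (inferInstance : MeasurableSpace (Set.Ico (0 : ℝ) 1))) (φ : MPE01)
    (C : Set (Set.Ico (0 : ℝ) 1)) (hC : MeasurableSet C) :
    ∀ η > (0 : ℝ), ∃ ε > (0 : ℝ), ∀ ψ : MPE01, wdist01 E φ ψ < ε → gnD φ ψ C < η := by
  have := gn_fin
  have hC' : MeasurableSet[MeasurableSpace.generateFrom (Set.range E)] C := by rw [hEgen]; exact hC
  clear hC
  induction C, hC' using MeasurableSpace.generateFrom_induction with
  | hC t ht _ =>
    obtain ⟨i, rfl⟩ := ht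
    intro η hη
    refine ⟨(2 : ℝ)⁻¹ ^ (i + 1) * η, by positivity, fun ψ hψ => ?_⟩
    exact lt_of_mul_lt_mul_left ((gn_gen E φ ψ i).trans_lt hψ) (by positivity)
  | empty => 
    intro η hη
    exact ⟨1, one_pos, fun ψ _ => by simpa [gnD] using hη⟩
  | compl t _ ih =>
    intro η hη
    obtain ⟨ε, hε, H⟩ := ih η hη
    refine ⟨ε, hε, fun ψ hψ => ?_⟩
    have := H ψ hψ
    unfold gnD at this ⊢
    rwa [Set.preimage_compl, Set.preimage_compl, compl_symmDiff_compl]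
  | iUnion f hf ih =>
    intro η hη
    rw [hEgen] at hf
    have hfm : ∀ i, MeasurableSet (f i) := hf
    have hacc : ∀ k, MeasurableSet (Set.accumulate f k) := fun k => by
      rw [Set.accumulate_def]
      exact MeasurableSet.iUnion fun i => MeasurableSet.iUnion fun _ => hfm i
    have hlim : Tendsto (fun k => lebesgue01.real ((⋃ i, f i) \ Set.accumulate f k)) atTop
        (nhds 0) := by
      have h0 := tendsto_measure_iInter_atTop (μ := lebesgue01)
        (s := fun k => (⋃ i, f i) \ Set.accumulate f k)
        (fun k => ((MeasurableSet.iUnion hfm).diff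
          (hacc k)).nullMeasurableSet)
        (fun a b hab => Set.diff_subset_diff_right (Set.monotone_accumulate hab))
        ⟨0, measure_ne_top _ _⟩
      rw [← Set.diff_iUnion, Set.iUnion_accumulate, Set.diff_self, measure_empty] at h0
      exact (ENNReal.tendsto_toReal ENNReal.zero_ne_top).comp h0
    obtain ⟨k, hk⟩ := (hlim.eventually (gt_mem_nhds (show 0 < η / 3 by positivity))).exists
    have hp : 0 < η / (3 * (k + 1 : ℕ)) := by positivity
    choose ε hε H using fun i => ih i _ hp
    obtain ⟨e, he, hle⟩ : ∃ e > (0 : ℝ), ∀ i ∈ Finset.range (k + 1), e ≤ ε i :=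
      ⟨(Finset.range (k + 1)).inf' (by simp) ε, by simp [Finset.lt_inf'_iff, hε],
        fun i hi => Finset.inf'_le _ hi⟩
    refine ⟨e, he, fun ψ hψ => ?_⟩
    set R := (⋃ i, f i) \ Set.accumulate f k with hR
    have hRm : MeasurableSet R := (MeasurableSet.iUnion hfm).diff (hacc k)
    have hsub : (⇑φ.1.symm ⁻¹' (⋃ i, f i)) ∆ (⇑ψ.1.symm ⁻¹' (⋃ i, f i)) ⊆
        ((⋃ i ∈ Finset.range (k + 1), (⇑φ.1.symm ⁻¹' (f i)) ∆ (⇑ψ.1.symm ⁻¹' (f i))) ∪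
        ⇑φ.1.symm ⁻¹' R) ∪ ⇑ψ.1.symm ⁻¹' R := by
      intro x hx
      by_contra hcon
      simp only [hR, Set.mem_union, Set.mem_iUnion, Set.mem_symmDiff, Set.mem_preimage,
        Set.mem_diff, Set.mem_accumulate, Finset.mem_range] at hx hcon
      push Not at hcon
      obtain ⟨⟨h1, h2⟩, h3⟩ := hcon
      rcases hx with ⟨⟨i, hi⟩, hx⟩ | ⟨⟨i, hi⟩, hx⟩
      · obtain ⟨j, hj, hj'⟩ := h2 ⟨i, hi⟩
        exact hx ⟨j, (h1 j (by omega)).1 hj'⟩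
      · obtain ⟨j, hj, hj'⟩ := h3 ⟨i, hi⟩
        exact hx ⟨j, (h1 j (by omega)).2 hj'⟩
    have e1 : lebesgue01.real (⇑φ.1.symm ⁻¹' R) = lebesgue01.real R := by
      rw [measureReal_def, (gn_symm φ).measure_preimage hRm.nullMeasurableSet]; rfl
    have e2 : lebesgue01.real (⇑ψ.1.symm ⁻¹' R) = lebesgue01.real R := by
      rw [measureReal_def, (gn_symm ψ).measure_preimage hRm.nullMeasurableSet]; rfl
    have e3 : lebesgue01.real
        (⋃ i ∈ Finset.range (k + 1), (⇑φ.1.symm ⁻¹' (f i)) ∆ (⇑ψ.1.symm ⁻¹' (f i))) ≤ η / 3 := by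
      refine (measureReal_biUnion_finset_le _ _).trans ?_
      refine (Finset.sum_le_card_nsmul _ _ (η / (3 * (k + 1 : ℕ))) fun i hi =>
        (H i ψ (hψ.trans_le (hle i hi))).le).trans (le_of_eq ?_)
      rw [Finset.card_range, nsmul_eq_mul]
      field_simp
    calc gnD φ ψ (⋃ i, f i) ≤ _ := measureReal_mono hsub
      _ ≤ _ := (measureReal_union_le _ _).trans (add_le_add_left (measureReal_union_le _ _) _)
      _ < η := by rw [e1, e2]; linarith

/-- For an invertible ergodic measure preserving transformation `T` of `([0,1), ℬ, μ)`, every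
positive integer `N` and every `δ > 0`, the set `G_N(T, δ)` is open in `(Φ, d)`, where `d` is
the metric attached to any sequence of measurable sets generating the Borel σ-field. -/
theorem GN_open
    (T : MPE01) (hTerg : Ergodic (⇑T.1) lebesgue01)
    (𝒞 : Set (Set (Set.Ico (0 : ℝ) 1))) (h𝒞 : ∀ C ∈ 𝒞, MeasurableSet C)
    (E : ℕ → Set (Set.Ico (0 : ℝ) 1)) (hEmeas : ∀ i, MeasurableSet (E i))
    (hEgen : MeasurableSpace.generateFrom (Set.range E) =
      (inferInstance : MeasurableSpace (Set.Ico (0 : ℝ) 1)))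
    (N : ℕ) (hN : 1 ≤ N) (δ : ℝ) (hδ : 0 < δ) :
    ∀ φ ∈ GN01 T 𝒞 δ N, ∃ ε > (0 : ℝ),
      ∀ ψ : MPE01, wdist01 E φ ψ < ε → ψ ∈ GN01 T 𝒞 δ N := by
  intro φ hφ
  obtain ⟨n, hn, C, hC, h⟩ := hφ
  obtain ⟨ε, hε, H⟩ := gn_cont E hEmeas hEgen φ C (h𝒞 C hC) _ (sub_pos.2 h)
  refine ⟨ε, hε, fun ψ hψ => ⟨n, hn, C, hC, ?_⟩⟩
  have h1 := H ψ hψ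
  have h2 := gn_birk_le T φ ψ C (h𝒞 C hC) n (hN.trans hn)
  change _ < _
  linarith
end

section
/- Let (X, S) be a measurable space and let C ⊆ S be a family of measurable sets with finite dual Vapnik–Chervonenkis dimension, i.e., there exists k ≥ 1 such that no collection of sets C_1, …, C_m ∈ C with m > k has a join ⋁_{i=1}^m C_i of cardinality 2^m. Then H_μ(C) = 0 for every probability measure μ on (X, S). -/
open MeasureTheory Filter

open Classical in
lemma vcz_card_cells {X : Type*} (𝒞 : Set (Set X)) (k : ℕ)
    (hVC : ∀ m : ℕ, k < m → ∀ C : Fin m → Set X, (∀ i, C i ∈ 𝒞) →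
      ¬ ∀ s : Fin m → Bool, (⋂ i, if s i then C i else (C i)ᶜ) ≠ ∅)
    {n : ℕ} (C : Fin n → Set X) (hC : ∀ i, C i ∈ 𝒞) :
    (Finset.univ.filter (fun s : Fin n → Bool =>
      (⋂ i, if s i then C i else (C i)ᶜ) ≠ ∅)).card ≤ (k + 1) * (n + 1) ^ k := by
  set A := Finset.univ.filter (fun s : Fin n → Bool =>
      (⋂ i, if s i then C i else (C i)ᶜ) ≠ ∅) with hA
  let g : (Fin n → Bool) → Finset (Fin n) := fun s => Finset.univ.filter (fun i => s i = true)
  have hg : Function.Injective g := by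
    intro s t h
    funext i
    have := congrArg (fun u => i ∈ u) h
    simp only [g, Finset.mem_filter, Finset.mem_univ, true_and, eq_iff_iff] at this
    exact Bool.eq_iff_iff.2 this
  have hvc : (A.image g).vcDim ≤ k := by
    refine Finset.sup_le fun t ht => ?_
    rw [Finset.mem_shatterer] at ht
    by_contra! hlt
    let e := t.equivFin.symm
    refine hVC t.card hlt (fun i => C (e i)) (fun i => hC _) fun s => ?_
    let u : Finset (Fin n) := (Finset.univ.filter (fun i => s i = true)).image (fun i => (e i : Fin n))
    have hu : u ⊆ t := by
      intro x hx
      simp only [u, Finset.mem_image] at hx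
      obtain ⟨i, _, rfl⟩ := hx
      exact (e i).2
    obtain ⟨v, hv, hvu⟩ := ht hu
    obtain ⟨r, hr, rfl⟩ := Finset.mem_image.1 hv
    simp only [hA, Finset.mem_filter, Finset.mem_univ, true_and] at hr
    obtain ⟨x, hx⟩ := Set.nonempty_iff_ne_empty.2 hr
    refine Set.nonempty_iff_ne_empty.1 ⟨x, ?_⟩
    rw [Set.mem_iInter] at hx ⊢
    intro i
    have h1 := hx (e i)
    have h2 : r (e i) = s i := by
      have := congrArg (fun u => (e i : Fin n) ∈ u) hvu
      simp only [g, u, Finset.mem_inter, Finset.mem_filter, Finset.mem_univ, true_and,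
        Finset.mem_image, eq_iff_iff, (e i).2] at this
      rw [Bool.eq_iff_iff, this]
      constructor
      · rintro ⟨j, hj, hji⟩
        have : j = i := e.injective (Subtype.ext hji)
        exact this ▸ hj
      · intro h
        exact ⟨i, h, rfl⟩
    rw [h2] at h1
    exact h1
  rw [← Finset.card_image_of_injective A hg]
  refine (Finset.card_le_card_shatterer _).trans (Finset.card_shatterer_le_sum_vcDim.trans ?_)
  calc _ ≤ ∑ j ∈ Finset.Iic k, (n + 1) ^ k := by
        refine (Finset.sum_le_sum_of_subset (Finset.Iic_subset_Iic.2 hvc)).trans ?_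
        refine Finset.sum_le_sum fun j hj => ?_
        rw [Fintype.card_fin]
        calc n.choose j ≤ n ^ j := Nat.choose_le_pow n j
          _ ≤ (n + 1) ^ j := Nat.pow_le_pow_left (by omega) _
          _ ≤ (n + 1) ^ k := Nat.pow_le_pow_right (by omega) (Finset.mem_Iic.1 hj)
    _ = _ := by simp

lemma vcz_point {p N : ℝ} (hp : 0 ≤ p) (hN : 0 < N) :
    -(p * Real.log p) ≤ p * Real.log N + (1 / N - p) := by
  rcases hp.eq_or_lt with rfl | hp
  · simp [hN.le]
  · have h := Real.log_le_sub_one_of_pos (show 0 < 1 / (p * N) by positivity)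
    rw [one_div, Real.log_inv, Real.log_mul hp.ne' hN.ne'] at h
    have h2 := mul_le_mul_of_nonneg_left h hp.le
    have h3 : p * ((p * N)⁻¹ - 1) = 1 / N - p := by field_simp
    rw [h3] at h2
    linarith

open Classical in
lemma vcz_sum {X : Type*} [MeasurableSpace X] (μ : Measure X) [IsProbabilityMeasure μ]
    {n : ℕ} (C : Fin n → Set X) (hC : ∀ i, MeasurableSet (C i)) :
    ∑ s : Fin n → Bool, (μ (⋂ i, if s i then C i else (C i)ᶜ)).toReal = 1 := by
  let f : X → (Fin n → Bool) := fun x i => decide (x ∈ C i)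
  have hf : ∀ s : Fin n → Bool, (⋂ i, if s i then C i else (C i)ᶜ) = f ⁻¹' {s} := by
    intro s
    ext x
    simp only [Set.mem_iInter, Set.mem_preimage, Set.mem_singleton_iff, f, funext_iff]
    refine forall_congr' fun i => ?_
    cases s i <;> simp
  have hm : ∀ s, MeasurableSet (f ⁻¹' {s}) := by
    intro s
    rw [← hf]
    refine MeasurableSet.iInter fun i => ?_
    split_ifs
    · exact hC i
    · exact (hC i).compl
  simp_rw [hf]
  rw [← ENNReal.toReal_sum (fun _ _ => measure_ne_top _ _),
    sum_measure_preimage_singleton _ (fun s _ => hm s)]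
  simp

open Classical in
lemma vcz_entropy {X : Type*} [MeasurableSpace X] (μ : Measure X) [IsProbabilityMeasure μ]
    {n : ℕ} (C : Fin n → Set X) (hC : ∀ i, MeasurableSet (C i)) (N : ℝ) (hN : 0 < N)
    (hcard : ((Finset.univ.filter (fun s : Fin n → Bool =>
      (⋂ i, if s i then C i else (C i)ᶜ) ≠ ∅)).card : ℝ) ≤ N) :
    0 ≤ joinEntropy μ C ∧ joinEntropy μ C ≤ Real.log N / Real.log 2 := by
  have hl2 : 0 < Real.log 2 := Real.log_pos (by norm_num)
  have key : joinEntropy μ C = (∑ s : Fin n → Bool,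
      -((μ (⋂ i, if s i then C i else (C i)ᶜ)).toReal *
      Real.log (μ (⋂ i, if s i then C i else (C i)ᶜ)).toReal)) / Real.log 2 := by
    unfold joinEntropy Real.logb
    rw [Finset.sum_div]
    refine Finset.sum_congr rfl fun s _ => ?_
    ring
  have hs := vcz_sum μ C hC
  rw [key]
  set p : (Fin n → Bool) → ℝ := fun s => (μ (⋂ i, if s i then C i else (C i)ᶜ)).toReal with hp
  change ∑ s, p s = 1 at hs
  change 0 ≤ (∑ s, -(p s * Real.log (p s))) / Real.log 2 ∧
    (∑ s, -(p s * Real.log (p s))) / Real.log 2 ≤ _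
  have hp0 : ∀ s, 0 ≤ p s := fun s => ENNReal.toReal_nonneg
  have hp1 : ∀ s, p s ≤ 1 := fun s => by
    rw [← hs]
    exact Finset.single_le_sum (fun i _ => hp0 i) (Finset.mem_univ s)
  constructor
  · refine div_nonneg (Finset.sum_nonneg fun s _ => ?_) hl2.le
    have := Real.log_nonpos (hp0 s) (hp1 s)
    nlinarith [hp0 s]
  · refine div_le_div_of_nonneg_right ?_ hl2.le
    set A := Finset.univ.filter (fun s : Fin n → Bool =>
      (⋂ i, if s i then C i else (C i)ᶜ) ≠ ∅) with hA
    have hz : ∀ s, s ∉ A → p s = 0 := by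
      intro s h
      simp only [hA, Finset.mem_filter, Finset.mem_univ, true_and, not_not] at h
      simp only [hp]
      rw [h]; simp
    have e1 : ∑ s ∈ A, p s = 1 := by
      rw [← hs]
      exact Finset.sum_subset (Finset.subset_univ _) fun s _ h => hz s h
    have e2 : ∑ s ∈ A, -(p s * Real.log (p s)) = ∑ s, -(p s * Real.log (p s)) :=
      Finset.sum_subset (Finset.subset_univ _) fun s _ h => by simp [hz s h]
    rw [← e2]
    calc _ ≤ ∑ s ∈ A, (p s * Real.log N + (1 / N - p s)) :=
          Finset.sum_le_sum fun s _ => vcz_point (hp0 s) hN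
      _ = Real.log N + (A.card / N - 1) := by
          rw [Finset.sum_add_distrib, ← Finset.sum_mul, Finset.sum_sub_distrib, e1]
          simp [div_eq_mul_inv]
      _ ≤ Real.log N := by
          have : (A.card : ℝ) / N ≤ 1 := (div_le_one hN).2 hcard
          linarith

lemma vcz_tendsto (k : ℕ) : Tendsto (fun n : ℕ =>
    Real.log ((k + 1) * ((n : ℝ) + 1) ^ k) / Real.log 2 / n) atTop (nhds 0) := by
  have h1 : Tendsto (fun n : ℕ => Real.log ((n : ℝ) + 1) / n) atTop (nhds 0) := by
    have h := (Real.isLittleO_log_id_atTop.tendsto_div_nhds_zero).comp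
      (tendsto_natCast_atTop_atTop (R := ℝ) |>.comp (tendsto_add_atTop_nat 1))
    have h3 : Tendsto (fun n : ℕ => 1 + 1 / (n : ℝ)) atTop (nhds (1 + 0)) :=
      tendsto_const_nhds.add (tendsto_const_div_atTop_nhds_zero_nat 1)
    have h2 := h.mul h3
    rw [zero_mul] at h2
    refine h2.congr' ?_
    filter_upwards [eventually_gt_atTop 0] with n hn
    have hn' : (0 : ℝ) < n := by exact_mod_cast hn
    simp only [Function.comp, id, Nat.cast_add, Nat.cast_one]
    field_simp
  have h2 := ((tendsto_const_div_atTop_nhds_zero_nat (Real.log (k + 1))).add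
    (h1.const_mul (k : ℝ))).div_const (Real.log 2)
  simp only [mul_zero, add_zero, zero_div] at h2
  refine h2.congr fun n => ?_
  rw [Real.log_mul (by positivity) (by positivity), Real.log_pow]
  ring

/-- A family of measurable sets with finite dual Vapnik–Chervonenkis dimension (no collection
of more than `k` sets from `𝒞` has a join with all `2^m` cells nonempty) has zero entropy for
every probability measure. -/
theorem zero_entropy_of_finite_VC_dimension
    {X : Type*} [MeasurableSpace X]
    (𝒞 : Set (Set X)) (h𝒞 : ∀ C ∈ 𝒞, MeasurableSet C)
    (k : ℕ) (hk : 1 ≤ k)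
    (hVC : ∀ m : ℕ, k < m → ∀ C : Fin m → Set X, (∀ i, C i ∈ 𝒞) →
      ¬ ∀ s : Fin m → Bool, (⋂ i, if s i then C i else (C i)ᶜ) ≠ ∅) :
    ∀ μ : Measure X, IsProbabilityMeasure μ → famEntropy μ 𝒞 = 0 := by
  intro μ hμ
  have key : ∀ S : {f : ℕ → Set X // ∀ i, f i ∈ 𝒞},
      Filter.liminf (fun n : ℕ => joinEntropy μ (fun i : Fin n => S.1 i) / n) Filter.atTop = 0 := by
    intro S
    have hb := fun n : ℕ => vcz_entropy μ (fun i : Fin n => S.1 i) (fun i => h𝒞 _ (S.2 i))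
      ((k + 1) * ((n : ℝ) + 1) ^ k) (by positivity)
      (by exact_mod_cast vcz_card_cells 𝒞 k hVC (fun i : Fin n => S.1 i) (fun i => S.2 i))
    refine Tendsto.liminf_eq (squeeze_zero (fun n => ?_) (fun n => ?_) (vcz_tendsto k))
    · exact div_nonneg (hb n).1 (Nat.cast_nonneg n)
    · exact div_le_div_of_nonneg_right (hb n).2 (Nat.cast_nonneg n)
  unfold famEntropy
  simp [key]
end

section
/- Let (X, S, μ) be a probability space and let C ⊆ S be a family of measurable sets. Suppose there exists a fixed measurable set C₀ ∈ S such that for every δ > 0, at most finitely many sets C ∈ C satisfy μ(C △ C₀) > δ. Then H_μ(C) = 0. -/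
open MeasureTheory Filter

open scoped symmDiff


lemma zz_gibbs {ι κ : Type*} [Fintype ι] [Fintype κ] (p : ι → κ → ℝ) (hp : ∀ i j, 0 ≤ p i j)
    (h1 : ∑ i, ∑ j, p i j = 1) :
    ∑ i, ∑ j, Real.negMulLog (p i j) ≤
      ∑ i, Real.negMulLog (∑ j, p i j) + ∑ j, Real.negMulLog (∑ i, p i j) := by
  set q : ι → ℝ := fun i => ∑ j, p i j with hq
  set r : κ → ℝ := fun j => ∑ i, p i j with hr
  have hpq : ∀ i j, p i j ≤ q i := fun i j =>
    Finset.single_le_sum (f := fun j => p i j) (fun j _ => hp i j) (Finset.mem_univ j)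
  have hpr : ∀ i j, p i j ≤ r j := fun i j =>
    Finset.single_le_sum (f := fun i => p i j) (fun i _ => hp i j) (Finset.mem_univ i)
  have hpt : ∀ i j, Real.negMulLog (p i j) ≤
      (-(p i j * Real.log (q i)) + -(p i j * Real.log (r j))) + (q i * r j - p i j) := by
    intro i j
    rcases (hp i j).eq_or_lt with h | h
    · have := mul_nonneg ((hp i j).trans (hpq i j)) ((hp i j).trans (hpr i j))
      rw [← h]; simpa using this
    · have hqi := h.trans_le (hpq i j)
      have hrj := h.trans_le (hpr i j)
      have hl := Real.log_le_sub_one_of_pos (div_pos (mul_pos hqi hrj) h)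
      rw [Real.log_div (by positivity) (by positivity), Real.log_mul (by positivity) (by positivity)] at hl
      have := mul_le_mul_of_nonneg_left hl h.le
      have e : p i j * (q i * r j / p i j - 1) = q i * r j - p i j := by field_simp
      rw [e] at this
      unfold Real.negMulLog
      linarith
  have hr1 : ∑ j, r j = 1 := by rw [← h1, hr]; exact Finset.sum_comm
  have hq1 : ∑ i, q i = 1 := h1
  calc ∑ i, ∑ j, Real.negMulLog (p i j) ≤ ∑ i, ∑ j,
      ((-(p i j * Real.log (q i)) + -(p i j * Real.log (r j))) + (q i * r j - p i j)) :=
        Finset.sum_le_sum fun i _ => Finset.sum_le_sum fun j _ => hpt i j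
    _ = ∑ i, ∑ j, -(p i j * Real.log (q i)) + ∑ i, ∑ j, -(p i j * Real.log (r j))
        + ((∑ i, q i) * (∑ j, r j) - ∑ i, ∑ j, p i j) := by
        simp only [Finset.sum_add_distrib, Finset.sum_sub_distrib, Finset.sum_mul_sum]
    _ = _ := by
        rw [show ∑ i, ∑ j, p i j = 1 from h1, hr1, Finset.sum_comm (f := fun i j => -(p i j * Real.log (r j)))]
        simp only [Real.negMulLog, ← Finset.sum_mul, Finset.sum_neg_distrib, neg_mul]
        simp [hq, hr]

noncomputable def zzEnt {X ι : Type*} [MeasurableSpace X] (μ : Measure X) [Fintype ι]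
    (f : X → ι) : ℝ := ∑ i, Real.negMulLog (μ.real (f ⁻¹' {i}))

section
variable {X : Type*} [MeasurableSpace X] (μ : Measure X) [IsProbabilityMeasure μ]

lemma zz_nonneg {ι : Type*} [Fintype ι] (f : X → ι) : 0 ≤ zzEnt μ f :=
  Finset.sum_nonneg fun _ _ => Real.negMulLog_nonneg measureReal_nonneg measureReal_le_one

lemma zz_comp {ι κ : Type*} [Fintype ι] [Fintype κ] [MeasurableSpace ι]
    [MeasurableSingletonClass ι] (f : X → ι) (hf : Measurable f) (φ : ι → κ) :
    zzEnt μ (fun x => φ (f x)) ≤ zzEnt μ f := by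
  classical
  unfold zzEnt
  rw [← Finset.sum_fiberwise (s := Finset.univ) (g := φ) (f := fun i => Real.negMulLog (μ.real (f ⁻¹' {i})))]
  refine Finset.sum_le_sum fun j _ => ?_
  have hP : μ.real ((fun x => φ (f x)) ⁻¹' {j}) =
      ∑ i ∈ Finset.univ.filter (fun i => φ i = j), μ.real (f ⁻¹' {i}) := by
    rw [sum_measureReal_preimage_singleton _ (fun y _ => hf (measurableSet_singleton y))]
    congr 1; ext x; simp
  rw [Real.negMulLog, neg_mul, ← mul_neg]
  nth_rw 1 [hP]
  rw [Finset.sum_mul]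
  refine Finset.sum_le_sum fun i hi => ?_
  rw [Real.negMulLog, neg_mul, ← mul_neg]
  rcases (measureReal_nonneg (μ := μ) (s := f ⁻¹' {i})).eq_or_lt with h | h
  · rw [← h]; simp
  · refine mul_le_mul_of_nonneg_left (neg_le_neg (Real.log_le_log h ?_)) h.le
    apply measureReal_mono _ (measure_ne_top _ _)
    intro x hx
    simp at hi hx ⊢
    rw [hx, hi]

lemma zz_comp' {ι κ : Type*} [Fintype ι] [Fintype κ] [MeasurableSpace ι]
    [MeasurableSingletonClass ι] (f : X → ι) (hf : Measurable f) (φ : ι → κ)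
    (g : X → κ) (h : ∀ x, g x = φ (f x)) :
    zzEnt μ g ≤ zzEnt μ f := by
  rw [show g = fun x => φ (f x) from funext h]
  exact zz_comp μ f hf φ

lemma zz_prod {ι κ : Type*} [Fintype ι] [Fintype κ] [MeasurableSpace ι]
    [MeasurableSingletonClass ι] [MeasurableSpace κ]
    [MeasurableSingletonClass κ] (f : X → ι) (hf : Measurable f) (g : X → κ) (hg : Measurable g) :
    zzEnt μ (fun x => (f x, g x)) ≤ zzEnt μ f + zzEnt μ g := by
  classical
  have hm : Measurable (fun x => (f x, g x)) := hf.prodMk hg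
  have key := zz_gibbs (fun i j => μ.real ((fun x => (f x, g x)) ⁻¹' {(i, j)}))
    (fun _ _ => measureReal_nonneg) (by
      rw [← Fintype.sum_prod_type']
      rw [sum_measureReal_preimage_singleton _ (fun y _ => hm (measurableSet_singleton y))]
      simp)
  have e1 : ∀ i, ∑ j, μ.real ((fun x => (f x, g x)) ⁻¹' {(i, j)}) = μ.real (f ⁻¹' {i}) := by
    intro i
    have := sum_measureReal_preimage_singleton (μ := μ) (f := fun x => (f x, g x))
      (Finset.univ.map ⟨fun j : κ => (i, j), fun a b h => by simpa using h⟩)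
      (fun y _ => hm (measurableSet_singleton y))
    rw [Finset.sum_map] at this
    refine Eq.trans this ?_
    congr 1; ext x
    simp only [Set.mem_preimage, Finset.mem_coe, Finset.mem_map, Finset.mem_univ, true_and,
      Function.Embedding.coeFn_mk, Prod.mk.injEq, Set.mem_singleton_iff]
    exact ⟨fun ⟨_, h⟩ => (congrArg Prod.fst h).symm, fun h => ⟨g x, Prod.ext h.symm rfl⟩⟩
  have e2 : ∀ j, ∑ i, μ.real ((fun x => (f x, g x)) ⁻¹' {(i, j)}) = μ.real (g ⁻¹' {j}) := by
    intro j
    have := sum_measureReal_preimage_singleton (μ := μ) (f := fun x => (f x, g x))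
      (Finset.univ.map ⟨fun i : ι => (i, j), fun a b h => by simpa using h⟩)
      (fun y _ => hm (measurableSet_singleton y))
    rw [Finset.sum_map] at this
    refine Eq.trans this ?_
    congr 1; ext x
    simp only [Set.mem_preimage, Finset.mem_coe, Finset.mem_map, Finset.mem_univ, true_and,
      Function.Embedding.coeFn_mk, Prod.mk.injEq, Set.mem_singleton_iff]
    exact ⟨fun ⟨_, h⟩ => (congrArg Prod.snd h).symm, fun h => ⟨f x, Prod.ext rfl h.symm⟩⟩
  simp only [e1, e2] at key
  unfold zzEnt
  rw [Fintype.sum_prod_type]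
  exact key

open Classical in
noncomputable def zzB {X : Type*} (A : Set X) (x : X) : Bool := decide (x ∈ A)

lemma zzB_pre {X : Type*} (A : Set X) : zzB A ⁻¹' {true} = A := by ext x; simp [zzB]
lemma zzB_pre' {X : Type*} (A : Set X) : zzB A ⁻¹' {false} = Aᶜ := by ext x; simp [zzB]

lemma zzB_meas {A : Set X} (hA : MeasurableSet A) : Measurable (zzB A) :=
  measurable_to_bool (by rwa [zzB_pre])

lemma zzB_ent {A : Set X} (hA : MeasurableSet A) :
    zzEnt μ (zzB A) = Real.negMulLog (μ.real A) + Real.negMulLog (1 - μ.real A) := by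
  simp [zzEnt, zzB_pre, zzB_pre', probReal_compl_eq_one_sub hA]

lemma zz_join (E : ℕ → Set X) (hE : ∀ i, MeasurableSet (E i)) (c : ℝ)
    (hc : ∀ i, zzEnt μ (zzB (E i)) ≤ c) (n : ℕ) :
    zzEnt μ (fun x => fun i : Fin n => zzB (E i) x) ≤ n * c := by
  induction n with
  | zero =>
    have h2 : ∀ s : Fin 0 → Bool,
        (fun (x : X) => fun i : Fin 0 => zzB (E i) x) ⁻¹' {s} = Set.univ := by
      intro s
      ext x
      simp only [Set.mem_preimage, Set.mem_singleton_iff, Set.mem_univ, iff_true]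
      exact Subsingleton.elim _ _
    simp only [zzEnt, h2]
    simp
  | succ n ih =>
    have hm : Measurable (fun x => fun i : Fin n => zzB (E i) x) :=
      measurable_pi_lambda _ fun i => zzB_meas (hE i)
    refine (zz_comp' μ (fun x => ((fun i : Fin n => zzB (E i) x), zzB (E n) x))
      (hm.prodMk (zzB_meas (hE n)))
      (fun p => (Fin.snoc (α := fun _ => Bool) p.1 p.2 : Fin (n+1) → Bool)) _ (fun x => ?_)).trans ?_
    · funext i
      refine Fin.lastCases ?_ (fun i => ?_) i <;> simp
    refine (zz_prod μ _ hm _ (zzB_meas (hE n))).trans ?_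
    push_cast
    linarith [hc n]

lemma zz_joinEntropy {n : ℕ} (C : Fin n → Set X) :
    joinEntropy μ C = zzEnt μ (fun x i => zzB (C i) x) / Real.log 2 := by
  unfold joinEntropy zzEnt
  rw [Finset.sum_div]
  refine Finset.sum_congr rfl fun s _ => ?_
  have : (⋂ i, if s i then C i else (C i)ᶜ) = (fun x i => zzB (C i) x) ⁻¹' {s} := by
    ext x
    simp only [Set.mem_iInter, Set.mem_preimage, Set.mem_singleton_iff, funext_iff]
    refine forall_congr' fun i => ?_
    cases h : s i <;> simp [zzB]
  rw [this, Real.negMulLog, Real.logb, measureReal_def]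
  ring

lemma zz_small (ε : ℝ) (hε : 0 < ε) : ∃ δ > (0:ℝ), ∀ A : Set X, MeasurableSet A →
    μ.real A ≤ δ → zzEnt μ (zzB A) ≤ ε := by
  have hcont : Continuous (fun t : ℝ => Real.negMulLog t + Real.negMulLog (1 - t)) := by
    have := Real.continuous_negMulLog
    fun_prop
  obtain ⟨δ, hδ, h⟩ := Metric.continuous_iff.1 hcont 0 ε hε
  refine ⟨δ / 2, by positivity, fun A hA hle => ?_⟩
  rw [zzB_ent μ hA]
  have := h (μ.real A) (by
    rw [Real.dist_eq, sub_zero, abs_of_nonneg measureReal_nonneg]; linarith)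
  rw [Real.dist_eq] at this
  simp at this
  exact (le_abs_self _).trans this.le

lemma zz_bound (𝒞 : Set (Set X)) (h𝒞 : ∀ C ∈ 𝒞, MeasurableSet C)
    (C₀ : Set X) (hC₀ : MeasurableSet C₀)
    (hcl : ∀ δ > (0 : ℝ), {C ∈ 𝒞 | (μ (C ∆ C₀)).toReal > δ}.Finite)
    (S : ℕ → Set X) (hS : ∀ i, S i ∈ 𝒞) (ε : ℝ) (hε : 0 < ε) :
    ∃ K : ℝ, ∀ n : ℕ, zzEnt μ (fun x => fun i : Fin n => zzB (S i) x) ≤ K + n * ε := by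
  classical
  obtain ⟨δ, hδ, hsm⟩ := zz_small μ ε hε
  set F := (hcl δ hδ).toFinset with hF
  have hFm : ∀ A, A ∈ F ↔ A ∈ 𝒞 ∧ (μ (A ∆ C₀)).toReal > δ := by intro A; simp [hF]
  let V : X → (F → Bool) := fun x A => zzB A.1 x
  have hV : Measurable V := measurable_pi_lambda _ fun A => zzB_meas (h𝒞 _ ((hFm _).1 A.2).1)
  let E : ℕ → Set X := fun i => if S i ∈ F then ∅ else S i ∆ C₀
  have hE : ∀ i, MeasurableSet (E i) := by
    intro i; simp only [E]; split_ifs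
    · exact MeasurableSet.empty
    · exact (h𝒞 _ (hS i)).symmDiff hC₀
  have hEs : ∀ i, μ.real (E i) ≤ δ := by
    intro i; simp only [E]; split_ifs with h
    · simpa using hδ.le
    · rw [hFm] at h
      by_contra h'
      exact h ⟨hS i, not_le.1 h'⟩
  refine ⟨zzEnt μ (zzB C₀) + zzEnt μ V, fun n => ?_⟩
  have hJ : Measurable (fun x => fun i : Fin n => zzB (E i) x) :=
    measurable_pi_lambda _ fun i => zzB_meas (hE i)
  refine (zz_comp' μ (fun x => ((zzB C₀ x, V x), (fun i : Fin n => zzB (E i) x)))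
    (((zzB_meas hC₀).prodMk hV).prodMk hJ)
    (fun p => fun i : Fin n => if h : S i ∈ F then p.1.2 ⟨S i, h⟩ else xor (p.2 i) p.1.1)
    _ (fun x => ?_)).trans ?_
  · funext i
    by_cases h : S i ∈ F
    · simp only [h, V, dite_true]
    · by_cases h1 : x ∈ S i <;> by_cases h2 : x ∈ C₀ <;>
        simp [h, E, zzB, h1, h2, Set.mem_symmDiff]
  refine (zz_prod μ _ ((zzB_meas hC₀).prodMk hV) _ hJ).trans ?_
  have := zz_prod μ _ (zzB_meas hC₀) _ hV
  have := zz_join μ E hE ε (fun i => hsm _ (hE i) (hEs i)) n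
  linarith

end

theorem zero_entropy_of_clustered
    {X : Type*} [MeasurableSpace X] (μ : Measure X) [IsProbabilityMeasure μ]
    (𝒞 : Set (Set X)) (h𝒞 : ∀ C ∈ 𝒞, MeasurableSet C)
    (C₀ : Set X) (hC₀ : MeasurableSet C₀)
    (hcl : ∀ δ > (0 : ℝ), {C ∈ 𝒞 | (μ (C ∆ C₀)).toReal > δ}.Finite) :
    famEntropy μ 𝒞 = 0 := by
  unfold famEntropy
  have key : ∀ S : {f : ℕ → Set X // ∀ i, f i ∈ 𝒞},
      Filter.liminf (fun n : ℕ => joinEntropy μ (fun i : Fin n => S.1 i) / n) Filter.atTop = 0 := by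
    rintro ⟨S, hS⟩
    apply Filter.Tendsto.liminf_eq
    have hl : 0 < Real.log 2 := Real.log_pos (by norm_num)
    rw [Metric.tendsto_atTop]
    intro ε hε
    obtain ⟨K, hK⟩ := zz_bound μ 𝒞 h𝒞 C₀ hC₀ hcl S hS (ε * Real.log 2 / 2) (by positivity)
    obtain ⟨N, hN⟩ := exists_nat_gt (K / (ε * Real.log 2 / 2))
    refine ⟨N + 1, fun n hn => ?_⟩
    have hn0 : (0:ℝ) < n := by exact_mod_cast (by omega : 0 < n)
    have hNn : (N:ℝ) ≤ n := by exact_mod_cast (by omega : N ≤ n)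
    rw [zz_joinEntropy, Real.dist_eq, sub_zero, abs_of_nonneg
      (div_nonneg (div_nonneg (zz_nonneg μ _) hl.le) hn0.le), div_div,
      div_lt_iff₀ (by positivity)]
    have h2 := hN.trans_le hNn
    rw [div_lt_iff₀ (by positivity)] at h2
    have h3 := hK n
    calc _ ≤ _ := h3
      _ < _ := by nlinarith
  simp only [key]
  exact Real.iSup_const_zero
end

section
/- Let (X, S, μ) be a probability space and let C₁, C₂ ⊆ S be families of measurable sets with H_μ(C₁) = 0 and H_μ(C₂) = 0. Then H_μ(C₁ ∪ C₂) = 0. -/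
open MeasureTheory Filter

namespace ZEU
open Finset

noncomputable def phi {X : Type*} (S : ℕ → Set X) (n : ℕ) (x : X) : Fin n → Bool :=
  open Classical in fun i => decide (x ∈ S i)

noncomputable def p (a c : ℝ) : ℝ := a * Real.log c - a * Real.log a

lemma p_sum {ι : Type*} (F : Finset ι) (a c : ι → ℝ) (ha : ∀ i, 0 ≤ a i) (hac : ∀ i, a i ≤ c i) :
    ∑ i ∈ F, p (a i) (c i) ≤ p (∑ i ∈ F, a i) (∑ i ∈ F, c i) := by
  set A := ∑ i ∈ F, a i with hA
  set C := ∑ i ∈ F, c i with hC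
  have hA0 : 0 ≤ A := Finset.sum_nonneg fun i _ => ha i
  have hAC : A ≤ C := Finset.sum_le_sum fun i _ => hac i
  rcases hA0.eq_or_lt with h | h
  · have : ∀ i ∈ F, a i = 0 := (Finset.sum_eq_zero_iff_of_nonneg fun i _ => ha i).1 h.symm
    rw [← h, Finset.sum_eq_zero]
    · simp [p]
    · intro i hi; simp [p, this i hi]
  · have hC0 : 0 < C := h.trans_le hAC
    have key : ∀ i ∈ F, p (a i) (c i) ≤
        a i * (Real.log C - Real.log A) + (c i * (A / C) - a i) := by
      intro i _
      rcases (ha i).eq_or_lt with h0 | h0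
      · have := hac i
        rw [← h0] at this ⊢
        simp only [p]
        have : 0 ≤ c i * (A / C) := by positivity
        linarith
      · have hc : 0 < c i := h0.trans_le (hac i)
        have hl := Real.log_le_sub_one_of_pos (x := c i * A / (a i * C)) (by positivity)
        rw [Real.log_div (by positivity) (by positivity), Real.log_mul hc.ne' h.ne',
          Real.log_mul h0.ne' hC0.ne'] at hl
        have := mul_le_mul_of_nonneg_left hl h0.le
        have e : a i * (c i * A / (a i * C) - 1) = c i * (A / C) - a i := by
          field_simp
        rw [e] at this
        simp only [p]
        linarith
    refine (Finset.sum_le_sum key).trans ?_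
    rw [Finset.sum_add_distrib, Finset.sum_sub_distrib, ← Finset.sum_mul, ← Finset.sum_mul,
      ← hA, ← hC]
    have : C * (A / C) = A := by field_simp
    rw [this]; simp only [p]; linarith

noncomputable def g (a b : ℝ) : ℝ := Real.negMulLog a + Real.negMulLog b - Real.negMulLog (a + b)

lemma g_eq (a b : ℝ) : g a b = p a (a + b) + p b (a + b) := by
  simp only [g, p, Real.negMulLog]; ring

lemma g_sum {ι : Type*} (F : Finset ι) (a b : ι → ℝ) (ha : ∀ i, 0 ≤ a i) (hb : ∀ i, 0 ≤ b i) :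
    ∑ i ∈ F, g (a i) (b i) ≤ g (∑ i ∈ F, a i) (∑ i ∈ F, b i) := by
  simp only [g_eq, Finset.sum_add_distrib]
  rw [← Finset.sum_add_distrib]
  have h1 := p_sum F a (fun i => a i + b i) ha (fun i => by have := hb i; linarith)
  have h2 := p_sum F b (fun i => a i + b i) hb (fun i => by have := ha i; linarith)
  rw [Finset.sum_add_distrib] at *
  simp only [Finset.sum_add_distrib] at h1 h2
  linarith

lemma g_le (a b : ℝ) (ha : 0 ≤ a) (hb : 0 ≤ b) : g a b ≤ (a + b) * Real.log 2 := by
  have h := g_sum (Finset.univ : Finset Bool) (fun i => if i then a else b)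
    (fun i => if i then b else a) (by intro i; cases i <;> simpa) (by intro i; cases i <;> simpa)
  simp only [Fintype.sum_bool, if_true, Bool.false_eq_true, if_false] at h
  have e : g b a = g a b := by simp only [g]; rw [add_comm b a]; ring
  rw [e, add_comm b a] at h
  have e2 : g (a + b) (a + b) = 2 * ((a + b) * Real.log 2) := by
    simp only [g]
    rw [← two_mul (a + b), Real.negMulLog_mul]
    simp only [Real.negMulLog]; ring
  linarith

section
variable {X : Type*} [MeasurableSpace X] (μ : Measure X) [IsProbabilityMeasure μ]

/-- Conditional entropy (in nats). -/
noncomputable def h {ι : Type*} [Fintype ι] (φ : X → ι) (C : Set X) : ℝ :=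
  ∑ s : ι, g (μ.real (φ ⁻¹' {s} ∩ C)) (μ.real (φ ⁻¹' {s} ∩ Cᶜ))

lemma real_fiber {ι κ : Type*} [Fintype ι] [DecidableEq κ] (φ : X → ι)
    (hφ : ∀ s, MeasurableSet (φ ⁻¹' {s})) (r : ι → κ) (C : Set X) (hC : MeasurableSet C) (t : κ) :
    μ.real ((r ∘ φ) ⁻¹' {t} ∩ C) = ∑ s with r s = t, μ.real (φ ⁻¹' {s} ∩ C) := by
  rw [← measureReal_biUnion_finset]
  · congr 1; ext x; simp
  · intro s _ s' _ hs
    refine Set.disjoint_left.2 ?_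
    rintro x ⟨hx, _⟩ ⟨hx', _⟩
    exact hs (hx.symm.trans hx')
  · intro s _; exact (hφ s).inter hC

lemma h_mono {ι κ : Type*} [Fintype ι] [Fintype κ] (φ : X → ι)
    (hφ : ∀ s, MeasurableSet (φ ⁻¹' {s})) (r : ι → κ) (C : Set X) (hC : MeasurableSet C) :
    h μ φ C ≤ h μ (r ∘ φ) C := by
  classical
  simp only [h]
  rw [← Finset.sum_fiberwise (s := Finset.univ) (g := r)]
  refine Finset.sum_le_sum fun t _ => ?_
  rw [real_fiber μ φ hφ r C hC, real_fiber μ φ hφ r _ hC.compl]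
  exact g_sum _ _ _ (fun _ => measureReal_nonneg) (fun _ => measureReal_nonneg)

lemma h_le {ι : Type*} [Fintype ι] (φ : X → ι)
    (hφ : ∀ s, MeasurableSet (φ ⁻¹' {s})) (C : Set X) (hC : MeasurableSet C) :
    h μ φ C ≤ Real.log 2 := by
  refine (h_mono μ φ hφ (fun _ => ()) C hC).trans ?_
  simp only [h, Finset.univ_unique, Finset.sum_singleton]
  refine (g_le _ _ measureReal_nonneg measureReal_nonneg).trans ?_
  have : ((fun _ => ()) ∘ φ) ⁻¹' {default} = (Set.univ : Set X) := by ext; simp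
  rw [this, Set.univ_inter, Set.univ_inter, measureReal_add_measureReal_compl hC]
  simp

lemma cell (S : ℕ → Set X) (n : ℕ) (s : Fin n → Bool) :
    (⋂ i : Fin n, if s i then S i else (S i)ᶜ) = phi S n ⁻¹' {s} := by
  ext x
  simp only [Set.mem_iInter, Set.mem_preimage, Set.mem_singleton_iff, funext_iff, phi]
  refine forall_congr' fun i => ?_
  cases s i <;> simp

lemma meas (S : ℕ → Set X) (hS : ∀ i, MeasurableSet (S i)) (n : ℕ) (s : Fin n → Bool) :
    MeasurableSet (phi S n ⁻¹' {s}) := by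
  rw [← cell]
  refine MeasurableSet.iInter fun i => ?_
  split_ifs
  · exact hS i
  · exact (hS i).compl

noncomputable def J (S : ℕ → Set X) (n : ℕ) : ℝ :=
  ∑ s : Fin n → Bool, Real.negMulLog (μ.real (phi S n ⁻¹' {s}))

lemma joinE (S : ℕ → Set X) (n : ℕ) :
    joinEntropy μ (fun i : Fin n => S i) = J μ S n / Real.log 2 := by
  simp only [joinEntropy, J, cell, Finset.sum_div]
  refine Finset.sum_congr rfl fun s _ => ?_
  simp only [Real.negMulLog, Real.logb, Measure.real]; ring

lemma J_zero (S : ℕ → Set X) : J μ S 0 = 0 := by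
  have : ∀ s : Fin 0 → Bool, phi S 0 ⁻¹' {s} = Set.univ := by
    intro s; ext x; simp [eq_iff_true_of_subsingleton]
  simp [J, this]

lemma J_nonneg (S : ℕ → Set X) (n : ℕ) : 0 ≤ J μ S n :=
  Finset.sum_nonneg fun _ _ => Real.negMulLog_nonneg measureReal_nonneg measureReal_le_one

lemma J_succ (S : ℕ → Set X) (hS : ∀ i, MeasurableSet (S i)) (n : ℕ) :
    J μ S (n + 1) = J μ S n + h μ (phi S n) (S n) := by
  have e : ∀ (s : Fin n → Bool) (b : Bool), phi S (n + 1) ⁻¹' {Fin.snoc (α := fun _ => Bool) s b}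
      = phi S n ⁻¹' {s} ∩ (if b then S n else (S n)ᶜ) := by
    intro s b
    rw [← cell, ← cell]
    ext x
    simp only [Set.mem_inter_iff, Set.mem_iInter, Fin.forall_fin_succ', Fin.snoc_castSucc,
      Fin.snoc_last, Fin.val_last, Fin.val_castSucc]
  simp only [J, h]
  rw [← (Fin.snocEquiv (fun _ => Bool)).sum_comp, Fintype.sum_prod_type_right,
    ← Finset.sum_add_distrib]
  refine Finset.sum_congr rfl fun s _ => ?_
  simp only [Fintype.sum_bool, Fin.snocEquiv, Equiv.coe_fn_mk, e, if_true, Bool.false_eq_true,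
    if_false, g]
  have : μ.real (phi S n ⁻¹' {s} ∩ S n) + μ.real (phi S n ⁻¹' {s} ∩ (S n)ᶜ)
      = μ.real (phi S n ⁻¹' {s}) := by
    rw [← Set.diff_eq]; exact measureReal_inter_add_diff (hS n)
  rw [this]; ring

lemma J_le (S : ℕ → Set X) (hS : ∀ i, MeasurableSet (S i)) (n : ℕ) :
    J μ S n ≤ n * Real.log 2 := by
  induction n with
  | zero => simp [J_zero]
  | succ n ih =>
    rw [J_succ μ S hS]
    have := h_le μ (phi S n) (meas S hS n) (S n) (hS n)
    push_cast; linarith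

lemma sub_h (S : ℕ → Set X) (hS : ∀ i, MeasurableSet (S i)) (f : ℕ → ℕ) (hf : StrictMono f)
    (k : ℕ) : h μ (phi S (f k)) (S (f k)) ≤ h μ (phi (S ∘ f) k) ((S ∘ f) k) :=
  h_mono μ (phi S (f k)) (meas S hS _) (fun s (j : Fin k) => s ⟨f j, hf j.2⟩) _ (hS _)

lemma ratio_le (S : ℕ → Set X) (hS : ∀ i, MeasurableSet (S i)) (n : ℕ) :
    joinEntropy μ (fun i : Fin n => S i) / n ≤ 1 := by
  have hl := Real.log_pos (x := 2) (by norm_num)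
  rw [joinE, div_div]
  refine div_le_one_of_le₀ ?_ (by positivity)
  rw [mul_comm]; exact J_le μ S hS n

lemma ratio_nonneg (S : ℕ → Set X) (n : ℕ) :
    0 ≤ joinEntropy μ (fun i : Fin n => S i) / n := by
  have hl := Real.log_pos (x := 2) (by norm_num)
  rw [joinE]
  have := J_nonneg μ S n
  positivity

lemma bdd_le (S : ℕ → Set X) (hS : ∀ i, MeasurableSet (S i)) :
    IsBoundedUnder (· ≤ ·) atTop (fun n : ℕ => joinEntropy μ (fun i : Fin n => S i) / n) :=
  isBoundedUnder_of ⟨1, ratio_le μ S hS⟩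

lemma bdd_ge (S : ℕ → Set X) :
    IsBoundedUnder (· ≥ ·) atTop (fun n : ℕ => joinEntropy μ (fun i : Fin n => S i) / n) :=
  isBoundedUnder_of ⟨0, ratio_nonneg μ S⟩

lemma liminf_le_zero (𝒞 : Set (Set X)) (h𝒞 : ∀ C ∈ 𝒞, MeasurableSet C)
    (h₁ : famEntropy μ 𝒞 = 0) (S : ℕ → Set X) (hS : ∀ i, S i ∈ 𝒞) :
    liminf (fun n : ℕ => joinEntropy μ (fun i : Fin n => S i) / n) atTop ≤ 0 := by
  rw [← h₁]
  refine le_ciSup (f := fun S : {f : ℕ → Set X // ∀ i, f i ∈ 𝒞} =>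
    liminf (fun n : ℕ => joinEntropy μ (fun i : Fin n => S.1 i) / n) atTop) ?_ ⟨S, hS⟩
  refine ⟨1, ?_⟩
  rintro _ ⟨T, rfl⟩
  exact liminf_le_of_le (bdd_ge μ T.1) fun b hb => by
    obtain ⟨n, hn⟩ := hb.exists
    exact hn.trans (ratio_le μ T.1 (fun i => h𝒞 _ (T.2 i)) n)

/-- A sequence with frequent large increments has a good subsequence. -/
lemma no_freq (𝒞 : Set (Set X)) (h𝒞 : ∀ C ∈ 𝒞, MeasurableSet C)
    (h₁ : famEntropy μ 𝒞 = 0) (S : ℕ → Set X) (hS : ∀ i, MeasurableSet (S i))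
    (δ : ℝ) (hδ : 0 < δ)
    (hfr : ∃ᶠ n in atTop, δ * Real.log 2 < h μ (phi S n) (S n) ∧ S n ∈ 𝒞) : False := by
  have hl := Real.log_pos (x := 2) (by norm_num)
  obtain ⟨f, hf, hP⟩ := extraction_of_frequently_atTop hfr
  have hSf : ∀ i, MeasurableSet ((S ∘ f) i) := fun i => hS _
  have hJ : ∀ n : ℕ, n * (δ * Real.log 2) ≤ J μ (S ∘ f) n := by
    intro n
    induction n with
    | zero => simp [J_zero]
    | succ n ih =>
      rw [J_succ μ _ hSf]
      have h1 := sub_h μ S hS f hf n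
      have h2 := (hP n).1
      push_cast; linarith
  have hz := liminf_le_zero μ 𝒞 h𝒞 h₁ (S ∘ f) (fun i => (hP i).2)
  have : δ ≤ liminf (fun n : ℕ => joinEntropy μ (fun i : Fin n => (S ∘ f) i) / n) atTop := by
    refine le_liminf_of_le (bdd_le μ _ hSf).isCoboundedUnder_ge ?_
    filter_upwards [eventually_gt_atTop 0] with n hn
    have hn' : (0 : ℝ) < n := by exact_mod_cast hn
    rw [joinE, div_div, le_div_iff₀ (by positivity)]
    have := hJ n
    linarith
  linarith

end
end ZEU

/-- A union of two zero entropy families has zero entropy. -/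
theorem zero_entropy_union
    {X : Type*} [MeasurableSpace X] (μ : Measure X) [IsProbabilityMeasure μ]
    (𝒞₁ 𝒞₂ : Set (Set X))
    (h𝒞₁ : ∀ C ∈ 𝒞₁, MeasurableSet C) (h𝒞₂ : ∀ C ∈ 𝒞₂, MeasurableSet C)
    (h₁ : famEntropy μ 𝒞₁ = 0) (h₂ : famEntropy μ 𝒞₂ = 0) :
    famEntropy μ (𝒞₁ ∪ 𝒞₂) = 0 := by
  have hl := Real.log_pos (x := 2) (by norm_num)
  have hU : ∀ C ∈ 𝒞₁ ∪ 𝒞₂, MeasurableSet C := by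
    rintro C (h | h)
    · exact h𝒞₁ C h
    · exact h𝒞₂ C h
  apply le_antisymm
  · refine Real.iSup_le ?_ le_rfl
    rintro ⟨S, hSU⟩
    have hS : ∀ i, MeasurableSet (S i) := fun i => hU _ (hSU i)
    by_contra! hpos
    simp only at hpos
    obtain ⟨δ, hδ, hδ'⟩ := exists_between hpos
    have hev := eventually_lt_of_lt_liminf hδ' (ZEU.bdd_ge μ S)
    have hnf : ¬ ∃ᶠ n in atTop, δ / 2 * Real.log 2 < ZEU.h μ (ZEU.phi S n) (S n) := by
      intro hfr
      have : ∃ᶠ n in atTop, (δ / 2 * Real.log 2 < ZEU.h μ (ZEU.phi S n) (S n) ∧ S n ∈ 𝒞₁) ∨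
          (δ / 2 * Real.log 2 < ZEU.h μ (ZEU.phi S n) (S n) ∧ S n ∈ 𝒞₂) :=
        hfr.mono fun n hn => (hSU n).imp (fun h => ⟨hn, h⟩) (fun h => ⟨hn, h⟩)
      rcases frequently_or_distrib.1 this with h | h
      · exact ZEU.no_freq μ 𝒞₁ h𝒞₁ h₁ S hS _ (by positivity) h
      · exact ZEU.no_freq μ 𝒞₂ h𝒞₂ h₂ S hS _ (by positivity) h
    rw [not_frequently] at hnf
    obtain ⟨N, hN⟩ := eventually_atTop.1 hnf
    have hJ : ∀ m : ℕ, ZEU.J μ S (N + m) ≤ N * Real.log 2 + m * (δ / 2 * Real.log 2) := by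
      intro m
      induction m with
      | zero => simpa using ZEU.J_le μ S hS N
      | succ m ih =>
        rw [← add_assoc, ZEU.J_succ μ S hS]
        have := hN (N + m) (by omega)
        push_cast; linarith
    obtain ⟨M, hM⟩ := exists_nat_gt (2 * N / δ)
    obtain ⟨n, hn, hn1, hn2, hn3⟩ := (hev.and ((eventually_ge_atTop N).and
      ((eventually_ge_atTop M).and (eventually_gt_atTop 0)))).exists
    obtain ⟨m, rfl⟩ := Nat.exists_eq_add_of_le hn1
    have hn' : (0 : ℝ) < (N + m : ℕ) := by exact_mod_cast hn3
    rw [ZEU.joinE, div_div, lt_div_iff₀ (by positivity)] at hn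
    have h3 : (M : ℝ) ≤ (N + m : ℕ) := by exact_mod_cast hn2
    have h4 := hM.trans_le h3
    rw [div_lt_iff₀ hδ] at h4
    have h5 := hJ m
    have h6 : δ * (N + m : ℕ) < N + m * (δ / 2) := by
      refine lt_of_mul_lt_mul_right ?_ hl.le
      linarith
    push_cast at h4 h6
    have : (0 : ℝ) ≤ N * δ := by positivity
    linarith
  · refine Real.iSup_nonneg fun T => ?_
    exact le_liminf_of_le (ZEU.bdd_le μ T.1 (fun i => hU _ (T.2 i))).isCoboundedUnder_ge
      (Eventually.of_forall (ZEU.ratio_nonneg μ T.1))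
end
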